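/- arXiv:1309.4986 — 2 statements merged into one kernel-verified Lean document; each statement's English description precedes it below -/
import Mathlib

section
/- Let d and r be positive integers and let J ⊊ I be squarefree monomial ideals of S such that I is minimally generated by r squarefree monomials f_1,…,f_r of degree d, J is either 0 or generated by squarefree monomials of degrees ≥ d+1, and there exists c ∈ C with supp c not contained in supp f_1 ∪ … ∪ supp f_r. Suppose that for every r' < r the following holds: whenever J' ⊊ I' are squarefree monomial ideals of a polynomial ring over K such that I' is minimally generated by r' squarefree monomials of degree d together with a set of squarefree monomials of degrees ≥ d+1, J' is either 0 or generated by squarefree monomials of degrees ≥ d+1, and the Stanley depth of I'/J' equals d+1, then the depth of I'/J' is at most d+1. If sdepth_S I/J = d+1, then depth_S I/J ≤ d+1. -/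
open MvPolynomial

/-- The squarefree monomial `∏_{i ∈ T} x_i` in `K[x_1,…,x_n]`. -/
noncomputable def sqm (K : Type*) [Field K] {n : ℕ} (T : Finset (Fin n)) :
    MvPolynomial (Fin n) K := ∏ i ∈ T, X i

/-- The poset `P_{I \ J}` of (supports of) squarefree monomials of `I \ J`. -/
def sqPoset {K : Type*} [Field K] {n : ℕ} (I J : Ideal (MvPolynomial (Fin n) K)) :
    Set (Finset (Fin n)) :=
  {T | sqm K T ∈ I ∧ sqm K T ∉ J}

/-- The squarefree monomials of degree `k` in `I \ J`. -/
def degSet {K : Type*} [Field K] {n : ℕ} (I J : Ideal (MvPolynomial (Fin n) K)) (k : ℕ) :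
    Set (Finset (Fin n)) :=
  {T ∈ sqPoset I J | T.card = k}

/-- A partition of `P_{I\J}` into intervals `[u,v]`, recorded as a finite set of
pairs `(u, v)`: each monomial of `P_{I\J}` lies in exactly one interval. -/
def IsIntervalPartition {K : Type*} [Field K] {n : ℕ}
    (I J : Ideal (MvPolynomial (Fin n) K))
    (F : Finset (Finset (Fin n) × Finset (Fin n))) : Prop :=
  (∀ p ∈ F, p.1 ∈ sqPoset I J ∧ p.2 ∈ sqPoset I J ∧ p.1 ⊆ p.2) ∧
  (∀ T ∈ sqPoset I J, ∃! p, p ∈ F ∧ p.1 ⊆ T ∧ T ⊆ p.2)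

/-- The Stanley depth of `I/J`: the maximum over interval partitions of the
minimal degree of an upper endpoint. -/
noncomputable def sdepth {K : Type*} [Field K] {n : ℕ}
    (I J : Ideal (MvPolynomial (Fin n) K)) : ℕ :=
  sSup {k | ∃ F, IsIntervalPartition I J F ∧ ∀ p ∈ F, k ≤ p.2.card}

/-- The depth of a module over `K[x_1,…,x_n]` with respect to the maximal ideal
`(x_1,…,x_n)`: the supremum of lengths of regular sequences from `(x_1,…,x_n)`. -/
noncomputable def mdepth {K : Type*} [Field K] {n : ℕ}
    (M : Type*) [AddCommGroup M] [Module (MvPolynomial (Fin n) K) M] : ℕ :=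
  sSup {k | ∃ rs : List (MvPolynomial (Fin n) K), rs.length = k ∧
    (∀ r ∈ rs, r ∈ Ideal.span (Set.range X : Set (MvPolynomial (Fin n) K))) ∧
    RingTheory.Sequence.IsRegular M rs}

/-- The `S`-module `I/J` (more precisely `I/(J ∩ I)`). -/
abbrev quotMod {K : Type*} [Field K] {n : ℕ} (I J : Ideal (MvPolynomial (Fin n) K)) :=
  I ⧸ (Submodule.comap I.subtype J)

/-- `depth_S I/J`. -/
noncomputable def depthIJ {K : Type*} [Field K] {n : ℕ}
    (I J : Ideal (MvPolynomial (Fin n) K)) : ℕ :=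
  mdepth (K := K) (n := n) (quotMod I J)

/-- An ideal is a squarefree monomial ideal generated in degrees `≥ d` if it is
the span of squarefree monomials whose supports have at least `d` elements. -/
def SqfreeGenFrom {K : Type*} [Field K] {n : ℕ}
    (L : Ideal (MvPolynomial (Fin n) K)) (d : ℕ) : Prop :=
  ∃ G : Set (Finset (Fin n)), (∀ T ∈ G, d ≤ T.card) ∧ L = Ideal.span (sqm K '' G)

/-- A squarefree monomial ideal. -/
def IsSqfreeMonomialIdeal {K : Type*} [Field K] {n : ℕ}
    (L : Ideal (MvPolynomial (Fin n) K)) : Prop :=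
  ∃ G : Set (Finset (Fin n)), L = Ideal.span (sqm K '' G)

/-! ### Koszul cohomology -/

section Koszul

variable {R ι : Type*} [CommRing R] [LinearOrder ι]

/-- The incidence sign of `v` in `F`. -/
def ksign (v : ι) (F : Finset ι) : ℤ := (-1) ^ (F.filter (· < v)).card

theorem ksign_mul_self (v : ι) (F : Finset ι) : ksign v F * ksign v F = 1 := by
  rw [ksign, ← mul_pow]; simp

theorem ksign_erase_of_lt {v w : ι} {F : Finset ι} (hv : v ∈ F) (h : v < w) :
    ksign w (F.erase v) = -ksign w F := by
  have h1 : (F.erase v).filter (· < w) = (F.filter (· < w)).erase v := by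
    ext a; simp only [Finset.mem_filter, Finset.mem_erase]; tauto
  have hm : v ∈ F.filter (· < w) := by simp [hv, h]
  rw [ksign, ksign, h1, ← Finset.card_erase_add_one hm, pow_succ]
  ring

theorem ksign_erase_of_gt {v w : ι} {F : Finset ι} (h : w < v) :
    ksign w (F.erase v) = ksign w F := by
  have h1 : (F.erase v).filter (· < w) = F.filter (· < w) := by
    ext a
    simp only [Finset.mem_filter, Finset.mem_erase]
    constructor
    · tauto
    · rintro ⟨h1, h2⟩
      exact ⟨⟨(h2.trans h).ne, h1⟩, h2⟩
  rw [ksign, ksign, h1]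

theorem ksign_swap {v w : ι} {F : Finset ι} (hv : v ∈ F) (hw : w ∈ F) (hne : v ≠ w) :
    ksign v F * ksign w (F.erase v) = -(ksign w F * ksign v (F.erase w)) := by
  rcases lt_or_gt_of_ne hne with h | h
  · rw [ksign_erase_of_lt hv h, ksign_erase_of_gt h]; ring
  · rw [ksign_erase_of_lt hw h, ksign_erase_of_gt h]; ring

variable (x : ι → R) {M A B C : Type*} [AddCommGroup M] [Module R M]
  [AddCommGroup A] [Module R A] [AddCommGroup B] [Module R B] [AddCommGroup C] [Module R C]

/-- The differential of the Koszul cochain complex of `M` with respect to the family `x`;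
its cochains of degree `j` are the functions on the `j`-element sets of indices. -/
def kdiff (g : Finset ι → M) (F : Finset ι) : M :=
  ∑ v ∈ F, ksign v F • (x v • g (F.erase v))

theorem kdiff_map (φ : A →ₗ[R] B) (g : Finset ι → A) (F : Finset ι) :
    kdiff x (fun G => φ (g G)) F = φ (kdiff x g F) := by
  simp [kdiff, map_sum]

theorem kdiff_add (g h : Finset ι → M) (F : Finset ι) :
    kdiff x (fun G => g G + h G) F = kdiff x g F + kdiff x h F := by
  simp [kdiff, Finset.sum_add_distrib]

theorem kdiff_sub (g h : Finset ι → M) (F : Finset ι) :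
    kdiff x (fun G => g G - h G) F = kdiff x g F - kdiff x h F := by
  simp [kdiff, smul_sub, Finset.sum_sub_distrib]

theorem kdiff_smul (r : R) (g : Finset ι → M) (F : Finset ι) :
    kdiff x (fun G => r • g G) F = r • kdiff x g F :=
  kdiff_map x (LinearMap.lsmul R M r) g F

theorem kdiff_congr {j : ℕ} {g h : Finset ι → M} (H : ∀ F : Finset ι, F.card = j → g F = h F)
    {F : Finset ι} (hF : F.card = j + 1) : kdiff x g F = kdiff x h F := by
  refine Finset.sum_congr rfl fun v hv => ?_
  rw [H _ (by rw [Finset.card_erase_of_mem hv, hF]; rfl)]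

theorem kdiff_kdiff (g : Finset ι → M) (F : Finset ι) : kdiff x (kdiff x g) F = 0 := by
  simp only [kdiff, Finset.smul_sum]
  rw [Finset.sum_sigma' F (fun v => F.erase v)]
  refine Finset.sum_involution (fun p _ => ⟨p.2, p.1⟩) ?_ ?_ ?_ ?_
  · rintro ⟨v, w⟩ h
    simp only [Finset.mem_sigma, Finset.mem_erase] at h
    obtain ⟨hv, hne, hw⟩ := h
    simp only
    rw [Finset.erase_right_comm (a := w), smul_comm (x v) (ksign w _), smul_smul,
      smul_comm (x w) (ksign v _), smul_smul, ksign_swap hv hw hne.symm]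
    simp only [smul_smul, mul_comm (x v) (x w), neg_smul, neg_add_cancel]
  · rintro ⟨v, w⟩ h _ heq
    simp only [Finset.mem_sigma, Finset.mem_erase] at h
    simp only [Sigma.mk.injEq, heq_eq_eq] at heq
    exact h.2.1 heq.1
  · rintro ⟨v, w⟩ h
    simp only [Finset.mem_sigma, Finset.mem_erase] at h ⊢
    exact ⟨h.2.2, h.2.1.symm, h.1⟩
  · rintro ⟨v, w⟩ _
    rfl

theorem kdiff_homotopy {j : ℕ} {g : Finset ι → M}
    (hg : ∀ F : Finset ι, F.card = j + 1 → kdiff x g F = 0) {y : R}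
    (hy : y ∈ Ideal.span (Set.range x)) :
    ∃ h : Finset ι → M, ∀ F : Finset ι, F.card = j → kdiff x h F = y • g F := by
  induction hy using Submodule.span_induction with
  | mem y hy =>
    obtain ⟨u, rfl⟩ := hy
    refine ⟨fun F => if u ∈ F then 0 else ksign u (insert u F) • g (insert u F), fun F hF => ?_⟩
    by_cases hu : u ∈ F
    · rw [kdiff, Finset.sum_eq_single_of_mem u hu]
      · simp [smul_comm (x u) (ksign u F), smul_smul, ksign_mul_self, Finset.insert_erase hu]
      · intro v hv hne
        simp [hu, hne.symm]
    · have h1 := hg (insert u F) (by rw [Finset.card_insert_of_notMem hu, hF])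
      rw [kdiff, Finset.sum_insert hu, Finset.erase_insert hu] at h1
      have h2 := congrArg (fun m => ksign u (insert u F) • m) h1
      simp only [smul_add, smul_zero, smul_smul, ksign_mul_self, one_smul] at h2
      rw [eq_comm, eq_neg_of_add_eq_zero_left h2, neg_eq_iff_add_eq_zero, kdiff, Finset.smul_sum,
        ← Finset.sum_add_distrib]
      refine Finset.sum_eq_zero fun v hv => ?_
      have hne : u ≠ v := fun h => hu (h ▸ hv)
      have h3 := ksign_swap (Finset.mem_insert_self u F) (Finset.mem_insert_of_mem hv) hne
      rw [Finset.erase_insert hu] at h3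
      have h4 : (insert u F).erase v = insert u (F.erase v) :=
        Finset.erase_insert_of_ne hne
      have h5 : u ∉ F.erase v := fun h => hu (Finset.mem_of_mem_erase h)
      rw [if_neg h5, smul_comm (x v) (ksign u _), smul_smul, smul_smul]
      rw [h4] at h3 ⊢
      have h6 : ksign u (insert u F) * ksign v (insert u F)
          = -(ksign v F * ksign u (insert u (F.erase v))) := by
        have a1 := ksign_mul_self u (insert u F)
        have a2 := ksign_mul_self u (insert u (F.erase v))
        linear_combination (ksign v (insert u F) * ksign u (insert u F)) * (-a2) +
          ksign u (insert u F) * ksign u (insert u (F.erase v)) * h3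
          - ksign v F * ksign u (insert u (F.erase v)) * a1
      rw [h6, neg_smul, neg_add_cancel]
  | zero => exact ⟨fun _ => 0, fun F _ => by simp [kdiff]⟩
  | add a b _ _ iha ihb =>
    obtain ⟨h, hh⟩ := iha
    obtain ⟨h', hh'⟩ := ihb
    exact ⟨fun F => h F + h' F, fun F hF => by rw [kdiff_add, hh F hF, hh' F hF, add_smul]⟩
  | smul a b _ ih =>
    obtain ⟨h, hh⟩ := ih
    exact ⟨fun F => a • h F, fun F hF => by rw [kdiff_smul, hh F hF, smul_smul, smul_eq_mul]⟩

variable (M) in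
/-- The Koszul cohomology of `M` with respect to `x` vanishes in all degrees below `k`. -/
def KoszulVanishesBelow (k : ℕ) : Prop :=
  ∀ j < k, ∀ g : Finset ι → M, (∀ F : Finset ι, F.card = j + 1 → kdiff x g F = 0) →
    ∃ h : Finset ι → M, ∀ F : Finset ι, F.card = j → kdiff x h F = g F

variable {x}

theorem exists_kdiff_eq_of_exact {α : A →ₗ[R] B} {β : B →ₗ[R] C} (hα : Function.Injective α)
    (hβ : Function.Surjective β) (hex : Function.Exact α β) {k j : ℕ}
    (hC : KoszulVanishesBelow x C k) (hj : j < k + 1)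
    {g : Finset ι → A} {h : Finset ι → B}
    (hh : ∀ F : Finset ι, F.card = j → kdiff x h F = α (g F)) :
    ∃ l : Finset ι → A, ∀ F : Finset ι, F.card = j → kdiff x l F = g F := by
  cases j with
  | zero =>
    refine ⟨fun _ => 0, fun F hF => hα ?_⟩
    rw [← hh F hF]
    rw [Finset.card_eq_zero.1 hF]
    simp [kdiff]
  | succ j =>
    obtain ⟨l, hl⟩ := hC j (by omega) (fun G => β (h G)) fun F hF => by
      rw [kdiff_map, hh F hF, hex.apply_apply_eq_zero]
    choose s hs using hβ
    have key : ∀ F : Finset ι, ∃ m : A, F.card = j →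
        α m = h F - kdiff x (fun G => s (l G)) F := by
      intro F
      by_cases hF : F.card = j
      · obtain ⟨m, hm⟩ := (hex (h F - kdiff x (fun G => s (l G)) F)).1 (by
          rw [map_sub, ← kdiff_map, ← hl F hF]; simp [hs])
        exact ⟨m, fun _ => hm⟩
      · exact ⟨0, fun h => absurd h hF⟩
    choose m hm using key
    refine ⟨m, fun F hF => hα ?_⟩
    rw [← kdiff_map, kdiff_congr x hm hF, kdiff_sub, kdiff_kdiff, sub_zero, hh F hF]

theorem KoszulVanishesBelow.left_of_exact {α : A →ₗ[R] B} {β : B →ₗ[R] C}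
    (hα : Function.Injective α) (hβ : Function.Surjective β) (hex : Function.Exact α β) {k : ℕ}
    (hB : KoszulVanishesBelow x B (k + 1)) (hC : KoszulVanishesBelow x C k) :
    KoszulVanishesBelow x A (k + 1) := by
  intro j hj g hg
  obtain ⟨h, hh⟩ := hB j hj (fun G => α (g G)) fun F hF => by rw [kdiff_map, hg F hF, map_zero]
  exact exists_kdiff_eq_of_exact hα hβ hex hC hj hh

theorem KoszulVanishesBelow.right_of_exact {α : A →ₗ[R] B} {β : B →ₗ[R] C}
    (hα : Function.Injective α) (hβ : Function.Surjective β) (hex : Function.Exact α β) {k : ℕ}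
    (hA : KoszulVanishesBelow x A (k + 1)) (hB : KoszulVanishesBelow x B k) :
    KoszulVanishesBelow x C k := by
  intro j hj g hg
  choose s hs using hβ
  have key : ∀ F : Finset ι, ∃ m : A, F.card = j + 1 → α m = kdiff x (fun G => s (g G)) F := by
    intro F
    by_cases hF : F.card = j + 1
    · obtain ⟨m, hm⟩ := (hex (kdiff x (fun G => s (g G)) F)).1 (by
        rw [← kdiff_map, ← hg F hF]; simp [hs])
      exact ⟨m, fun _ => hm⟩
    · exact ⟨0, fun h => absurd h hF⟩
  choose m hm using key
  obtain ⟨l, hl⟩ := hA (j + 1) (by omega) m fun F hF => hα (by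
    rw [← kdiff_map, kdiff_congr x hm hF, kdiff_kdiff, map_zero])
  obtain ⟨h, hh⟩ := hB j hj (fun G => s (g G) - α (l G)) fun F hF => by
    rw [kdiff_sub, ← hm F hF, kdiff_map, hl F hF, sub_self]
  refine ⟨fun G => β (h G), fun F hF => ?_⟩
  rw [kdiff_map, hh F hF, map_sub, hs, hex.apply_apply_eq_zero, sub_zero]

theorem KoszulVanishesBelow.of_regular {β : M →ₗ[R] C} {y : R}
    (hy : y ∈ Ideal.span (Set.range x)) (hreg : IsSMulRegular M y)
    (hβ : Function.Surjective β) (hex : Function.Exact (LinearMap.lsmul R M y) β) {k : ℕ}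
    (hC : KoszulVanishesBelow x C k) : KoszulVanishesBelow x M (k + 1) := by
  intro j hj g hg
  obtain ⟨h, hh⟩ := kdiff_homotopy x hg hy
  exact exists_kdiff_eq_of_exact (α := LinearMap.lsmul R M y) hreg hβ hex hC hj hh

theorem KoszulVanishesBelow.congr (e : A ≃ₗ[R] B) {k : ℕ}
    (hA : KoszulVanishesBelow x A k) : KoszulVanishesBelow x B k := by
  intro j hj g hg
  obtain ⟨h, hh⟩ := hA j hj (fun G => e.symm (g G)) fun F hF => by
    have := kdiff_map x e.symm.toLinearMap g F
    simp only [LinearEquiv.coe_coe] at this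
    rw [this, hg F hF, map_zero]
  refine ⟨fun G => e (h G), fun F hF => ?_⟩
  have := kdiff_map x e.toLinearMap h F
  simp only [LinearEquiv.coe_coe] at this
  rw [this, hh F hF, e.apply_symm_apply]

theorem KoszulVanishesBelow.mono {k l : ℕ} (h : KoszulVanishesBelow x M l) (hkl : k ≤ l) :
    KoszulVanishesBelow x M k :=
  fun j hj => h j (hj.trans_le hkl)

end Koszul

section Depth

open scoped Pointwise

variable {R ι : Type*} [CommRing R] [LinearOrder ι] {x : ι → R}
  {M : Type*} [AddCommGroup M] [Module R M]

theorem exact_lsmul_mkQ (y : R) :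
    Function.Exact (LinearMap.lsmul R M y) (Submodule.mkQ (y • (⊤ : Submodule R M))) := by
  intro m
  rw [Submodule.mkQ_apply, Submodule.Quotient.mk_eq_zero, Submodule.mem_smul_pointwise_iff_exists]
  simp

theorem KoszulVanishesBelow.of_isWeaklyRegular {rs : List R}
    (hrs : ∀ r ∈ rs, r ∈ Ideal.span (Set.range x))
    (h : RingTheory.Sequence.IsWeaklyRegular M rs) : KoszulVanishesBelow x M rs.length := by
  induction rs generalizing M with
  | nil => exact fun j hj => absurd hj (Nat.not_lt_zero j)
  | cons y rs ih =>
    rw [RingTheory.Sequence.isWeaklyRegular_cons_iff] at h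
    exact KoszulVanishesBelow.of_regular (hrs y (by simp)) h.1 (Submodule.mkQ_surjective _)
      (exact_lsmul_mkQ y) (ih (fun r hr => hrs r (by simp [hr])) h.2)

theorem KoszulVanishesBelow.exists_isSMulRegular [IsNoetherianRing R] [Module.Finite R M] {k : ℕ}
    (h : KoszulVanishesBelow x M (k + 1)) :
    ∃ y ∈ Ideal.span (Set.range x), IsSMulRegular M y := by
  by_contra! hcon
  have hsub : (Ideal.span (Set.range x) : Set R) ⊆
      ⋃ p ∈ associatedPrimes R M, ((id p : Ideal R) : Set R) := by
    simp only [id]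
    rw [biUnion_associatedPrimes_eq_zero_divisors]
    intro y hy
    have := hcon y hy
    rw [isSMulRegular_iff_right_eq_zero_of_smul] at this
    push Not at this
    obtain ⟨m, h1, h2⟩ := this
    exact ⟨m, h2, h1⟩
  obtain ⟨p, hp, hle⟩ := (Ideal.subset_union_prime_finite (associatedPrimes.finite R M) ⊥ ⊥
    fun p hp _ _ => (AssociatedPrimes.mem_iff.1 hp).isPrime).1 hsub
  obtain ⟨hpp, m, hm⟩ := (isAssociatedPrime_iff).1 (AssociatedPrimes.mem_iff.1 hp)
  have hxm : ∀ v, x v • m = 0 := fun v => by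
    have : x v ∈ p := hle (Ideal.subset_span ⟨v, rfl⟩)
    rw [hm] at this
    simpa [Submodule.mem_colon_singleton] using this
  obtain ⟨l, hl⟩ := h 0 (by omega) (fun _ => m) fun F _ => by simp [kdiff, hxm]
  have hm0 : m = 0 := by
    have := hl ∅ rfl
    simpa [kdiff] using this.symm
  subst hm0
  exact hpp.ne_top (by rw [hm]; ext; simp [Submodule.mem_colon_singleton])

theorem KoszulVanishesBelow.exists_isRegular [IsNoetherianRing R] [Module.Finite R M] {k : ℕ}
    (h : KoszulVanishesBelow x M k)
    (hM : Ideal.span (Set.range x) • (⊤ : Submodule R M) ≠ ⊤) :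
    ∃ rs : List R, rs.length = k ∧ (∀ r ∈ rs, r ∈ Ideal.span (Set.range x)) ∧
      RingTheory.Sequence.IsRegular M rs := by
  induction k generalizing M with
  | zero =>
    refine ⟨[], rfl, by simp, ?_⟩
    rw [RingTheory.Sequence.isRegular_iff]
    refine ⟨RingTheory.Sequence.IsWeaklyRegular.nil R M, fun h => hM ?_⟩
    simp only [Ideal.ofList_nil, Submodule.bot_smul] at h
    rw [h, eq_bot_iff]
    exact Submodule.smul_le.2 fun r _ n hn => by rw [Submodule.mem_bot] at hn ⊢; simp [hn]
  | succ k ih =>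
    obtain ⟨y, hy, hreg⟩ := h.exists_isSMulRegular
    have h1 : KoszulVanishesBelow x (QuotSMulTop y M) k :=
      KoszulVanishesBelow.right_of_exact (α := LinearMap.lsmul R M y) hreg
        (Submodule.mkQ_surjective _) (exact_lsmul_mkQ y) h (h.mono (by omega))
    obtain ⟨rs, hl, hmem, hrs⟩ := ih h1 (fun htop => hM (by
      have h2 := congrArg (Submodule.comap (Submodule.mkQ (y • (⊤ : Submodule R M)))) htop
      have h3 : Submodule.map (Submodule.mkQ (y • (⊤ : Submodule R M)))
          (Ideal.span (Set.range x) • (⊤ : Submodule R M)) =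
          Ideal.span (Set.range x) • (⊤ : Submodule R (QuotSMulTop y M)) := by
        rw [Submodule.map_smul'', Submodule.map_top, Submodule.range_mkQ]
      rw [← h3, Submodule.comap_map_mkQ, Submodule.comap_top, sup_eq_right.2] at h2
      · exact h2
      · rintro _ ⟨m, -, rfl⟩
        exact Submodule.smul_mem_smul hy trivial))
    refine ⟨y :: rs, by simp [hl], ?_, ?_⟩
    · intro r hr
      rcases List.mem_cons.1 hr with rfl | hr
      · exact hy
      · exact hmem r hr
    · rw [RingTheory.Sequence.isRegular_cons_iff]
      exact ⟨hreg, hrs⟩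

theorem KoszulVanishesBelow.le_card [Fintype ι] {k : ℕ} (h : KoszulVanishesBelow x M k)
    (hM : Ideal.span (Set.range x) • (⊤ : Submodule R M) ≠ ⊤) : k ≤ Fintype.card ι := by
  by_contra! hk
  refine hM (eq_top_iff.2 fun m _ => ?_)
  obtain ⟨l, hl⟩ := h _ hk (fun _ => m) fun F hF => by
    have := Finset.card_le_univ F
    omega
  rw [← hl Finset.univ Finset.card_univ]
  refine Submodule.sum_mem _ fun v _ => ?_
  exact Submodule.smul_of_tower_mem _ _
    (Submodule.smul_mem_smul (Ideal.subset_span ⟨v, rfl⟩) trivial)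

end Depth

section Hall

theorem exists_injective_ne_zero_of_rows_independent {K ι κ : Type*} [Field K] [DecidableEq κ]
    [Fintype ι] [Fintype κ] (w : ι → κ → K)
    (hw : ∀ a : ι → K, (∀ c, ∑ i, a i * w i c = 0) → a = 0) :
    ∃ m : ι → κ, Function.Injective m ∧ ∀ i, w i (m i) ≠ 0 := by
  classical
  obtain ⟨m, hm, hmt⟩ := (Finset.all_card_le_biUnion_card_iff_exists_injective
    (fun i => Finset.univ.filter fun c => w i c ≠ 0)).1 fun s => by
    by_contra! hlt
    set N := s.biUnion fun i => Finset.univ.filter fun c => w i c ≠ 0 with hN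
    let L : (s → K) →ₗ[K] (N → K) := (Matrix.of fun (i : s) (c : N) => w i c).vecMulLinear
    have hker : LinearMap.ker L ≠ ⊥ := LinearMap.ker_ne_bot_of_finrank_lt (by simpa using hlt)
    obtain ⟨a, ha, ha0⟩ := (Submodule.ne_bot_iff _).1 hker
    refine ha0 ?_
    have h0 := hw (fun i => if h : i ∈ s then a ⟨i, h⟩ else 0) fun c => by
      by_cases hc : c ∈ N
      · have := congrFun (LinearMap.mem_ker.1 ha) ⟨c, hc⟩
        simp only [L, Matrix.vecMulLinear_apply, Matrix.vecMul, dotProduct, Matrix.of_apply,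
          Pi.zero_apply] at this
        refine Eq.trans ?_ this
        rw [← Finset.sum_subset (Finset.subset_univ s), ← Finset.sum_coe_sort s]
        · simp
        · intro i _ hi
          simp [hi]
      · refine Finset.sum_eq_zero fun i _ => ?_
        by_cases hi : i ∈ s
        · have : w i c = 0 := by
            by_contra hne
            exact hc (Finset.mem_biUnion.2 ⟨i, hi, by simp [hne]⟩)
          simp [this]
        · simp [hi]
    ext i
    have := congrFun h0 i
    simpa using this
  exact ⟨m, hm, fun i => by simpa using hmt i⟩

end Hall

section Partition

variable {α : Type*} [DecidableEq α] [Fintype α]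

/-- A partition of the family `P` of finite sets into intervals, recorded by their endpoints. -/
def IsIntervalPartitionOf (P : Set (Finset α)) (F : Finset (Finset α × Finset α)) : Prop :=
  (∀ p ∈ F, p.1 ∈ P ∧ p.2 ∈ P ∧ p.1 ⊆ p.2) ∧
  (∀ T ∈ P, ∃! p, p ∈ F ∧ p.1 ⊆ T ∧ T ⊆ p.2)

theorem exists_intervalPartition_of_matching {P : Set (Finset α)} {k : ℕ}
    (hk : ∀ T ∈ P, k ≤ T.card) {m : Finset α → Finset α}
    (hm : ∀ u ∈ P, u.card = k → m u ∈ P ∧ u ⊆ m u ∧ (m u).card = k + 1)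
    (hinj : ∀ u ∈ P, u.card = k → ∀ u' ∈ P, u'.card = k → m u = m u' → u = u') :
    ∃ F, IsIntervalPartitionOf P F ∧ ∀ p ∈ F, k + 1 ≤ p.2.card := by
  classical
  let F : Finset (Finset α × Finset α) := Finset.univ.filter fun p =>
    (p.1 ∈ P ∧ p.1.card = k ∧ p.2 = m p.1) ∨
    (p.1 = p.2 ∧ p.1 ∈ P ∧ k + 1 ≤ p.1.card ∧ ∀ u ∈ P, u.card = k → m u ≠ p.1)
  have hF : ∀ p, p ∈ F ↔ (p.1 ∈ P ∧ p.1.card = k ∧ p.2 = m p.1) ∨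
    (p.1 = p.2 ∧ p.1 ∈ P ∧ k + 1 ≤ p.1.card ∧ ∀ u ∈ P, u.card = k → m u ≠ p.1) := by
    intro p; simp [F]
  -- a member of `P` in an interval `[u, m u]` is one of the two endpoints
  have hends : ∀ u ∈ P, u.card = k → ∀ T, u ⊆ T → T ⊆ m u → T = u ∨ T = m u := by
    intro u hu huk T h1 h2
    obtain ⟨-, -, h3⟩ := hm u hu huk
    have h4 := Finset.card_le_card h1
    have h5 := Finset.card_le_card h2
    by_cases h : T.card = k
    · exact Or.inl (Finset.eq_of_subset_of_card_le h1 (by omega)).symm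
    · exact Or.inr (Finset.eq_of_subset_of_card_le h2 (by omega))
  refine ⟨F, ⟨?_, ?_⟩, ?_⟩
  · rintro ⟨u, v⟩ hp
    rcases (hF _).1 hp with ⟨h1, h2, h3⟩ | ⟨h1, h2, -⟩
    · simp only at h1 h2 h3
      subst h3
      exact ⟨h1, (hm u h1 h2).1, (hm u h1 h2).2.1⟩
    · simp only at h1 h2
      subst h1
      exact ⟨h2, h2, subset_rfl⟩
  · intro T hT
    by_cases hTm : ∃ u ∈ P, u.card = k ∧ u ⊆ T ∧ T ⊆ m u
    · obtain ⟨u, hu, huk, h1, h2⟩ := hTm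
      refine ⟨(u, m u), ⟨(hF _).2 (Or.inl ⟨hu, huk, rfl⟩), h1, h2⟩, ?_⟩
      rintro ⟨a, b⟩ ⟨hp, h3, h4⟩
      simp only at h3 h4
      rcases (hF _).1 hp with ⟨ha, hak, hb⟩ | ⟨hab, ha, hak, hne⟩
      · simp only at ha hak hb
        subst hb
        have : a = u := by
          rcases hends u hu huk T h1 h2 with e | e <;> rcases hends a ha hak T h3 h4 with e' | e'
          · rw [← e, ← e']
          · have := (hm a ha hak).2.2
            rw [← e', e] at this; omega
          · have := (hm u hu huk).2.2
            rw [← e, e'] at this; omega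
          · exact hinj a ha hak u hu huk (by rw [← e, ← e'])
        rw [this]
      · simp only at hab ha hak hne
        subst hab
        have hTa : T = a := subset_antisymm h4 h3
        rcases hends u hu huk T h1 h2 with e | e
        · rw [← hTa, e] at hak; omega
        · exact absurd (e.symm.trans hTa) (hne u hu huk)
    · push Not at hTm
      have hTk : k + 1 ≤ T.card := by
        by_contra hlt
        have := hk T hT
        exact hTm T hT (by omega) subset_rfl (hm T hT (by omega)).2.1
      refine ⟨(T, T), ⟨(hF _).2 (Or.inr ⟨rfl, hT, hTk, ?_⟩), subset_rfl, subset_rfl⟩, ?_⟩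
      · intro u hu huk e
        simp only at e
        exact hTm u hu huk (e ▸ (hm u hu huk).2.1) e.ge
      · rintro ⟨a, b⟩ ⟨hp, h3, h4⟩
        simp only at h3 h4
        rcases (hF _).1 hp with ⟨ha, hak, hb⟩ | ⟨hab, -⟩
        · simp only at ha hak hb
          subst hb
          exact absurd h4 (hTm a ha hak h3)
        · simp only at hab
          subst hab
          rw [subset_antisymm h4 h3]
  · rintro ⟨u, v⟩ hp
    rcases (hF _).1 hp with ⟨h1, h2, h3⟩ | ⟨h1, -, h2, -⟩
    · simp only at h1 h2 h3 ⊢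
      rw [h3, (hm u h1 h2).2.2]
    · simp only at h1 h2 ⊢
      rwa [← h1]

theorem exists_intervalPartition_extend {P P' A : Set (Finset α)} {d : ℕ} {t : α}
    {c : Finset α → Finset α}
    (hgen : ∀ T ∈ P, ∃ u ∈ P, u.card = d ∧ t ∉ u ∧ u ⊆ T)
    (hAP : ∀ u ∈ A, u ∈ P) (hAd : ∀ u ∈ A, u.card = d) (hAt : ∀ u ∈ A, t ∉ u)
    (hcP : ∀ u ∈ A, c u ∈ P) (hcd : ∀ u ∈ A, (c u).card = d + 2)
    (hcsub : ∀ u ∈ A, insert t u ⊆ c u)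
    (hcinj : ∀ u ∈ A, ∀ u' ∈ A, c u = c u' → u = u')
    (hcA : ∀ u ∈ A, ∀ j ∈ P, j.card = d → j ⊆ c u → j ∈ A)
    (hP' : ∀ T, T ∈ P' ↔ T ∈ P ∧ ∀ u ∈ A, T ≠ u ∧ T ≠ insert t u)
    {F' : Finset (Finset α × Finset α)} (hF' : IsIntervalPartitionOf P' F')
    (htop : ∀ p ∈ F', d + 2 ≤ p.2.card) :
    ∃ F, IsIntervalPartitionOf P F ∧ ∀ p ∈ F, d + 2 ≤ p.2.card := by
  classical
  let X : Set (Finset α) := {T | ∃ u ∈ A, u ⊆ T ∧ T ⊆ c u}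
  have hcard : ∀ T ∈ P, d ≤ T.card := fun T hT => by
    obtain ⟨u, -, hu, -, hs⟩ := hgen T hT
    exact hu ▸ Finset.card_le_card hs
  have htc : ∀ u ∈ A, t ∈ c u := fun u hu => hcsub u hu (Finset.mem_insert_self _ _)
  have huc : ∀ u ∈ A, u ⊆ c u := fun u hu => (Finset.subset_insert _ _).trans (hcsub u hu)
  have hcard' : ∀ T ∈ P', d + 1 ≤ T.card ∨ (T.card = d ∧ T ∉ A) := fun T hT => by
    have := hcard T ((hP' T).1 hT).1
    by_cases h : T.card = d
    · exact Or.inr ⟨h, fun hA => (((hP' T).1 hT).2 T hA).1 rfl⟩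
    · left; omega
  have hXcl : ∀ a ∈ P', ∀ T ∈ X, a ⊆ T → a ∈ X := by
    rintro a ha T ⟨u, hu, h1, h2⟩ haT
    have hac : a ⊆ c u := haT.trans h2
    have haP := ((hP' a).1 ha).1
    obtain ⟨j, hjP, hjd, hjt, hja⟩ := hgen a haP
    have hjA := hcA u hu j hjP hjd (hja.trans hac)
    rcases hcard' a ha with h | ⟨h, hn⟩
    swap
    · have : j = a := Finset.eq_of_subset_of_card_le hja (by omega)
      exact absurd (this ▸ hjA) hn
    have hle := Finset.card_le_card hac
    rw [hcd u hu] at hle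
    by_cases h2 : a.card = d + 2
    · have : a = c u := Finset.eq_of_subset_of_card_le hac (by rw [hcd u hu, h2])
      exact ⟨u, hu, this ▸ huc u hu, this.le⟩
    · by_cases hta : t ∈ a
      · have h3 : insert t j ⊆ a := Finset.insert_subset hta hja
        have h4 : insert t j = a := Finset.eq_of_subset_of_card_le h3 (by
          rw [Finset.card_insert_of_notMem hjt]; omega)
        exact absurd h4.symm (((hP' a).1 ha).2 j hjA).2
      · have h3 : a ⊆ (c u).erase t := fun z hz =>
          Finset.mem_erase.2 ⟨fun e => hta (e ▸ hz), hac hz⟩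
        have h4 : a = (c u).erase t := Finset.eq_of_subset_of_card_le h3 (by
          rw [Finset.card_erase_of_mem (htc u hu), hcd u hu]; omega)
        refine ⟨u, hu, ?_, hac⟩
        rw [h4]
        exact fun z hz => Finset.mem_erase.2 ⟨fun e => hAt u hu (e ▸ hz), huc u hu hz⟩
  have hdisj : ∀ T, ∀ u ∈ A, u ⊆ T → T ⊆ c u → ∀ u' ∈ A, u' ⊆ T → T ⊆ c u' → u = u' := by
    intro T u hu h1 h2 u' hu' h1' h2'
    have key : ∀ u ∈ A, u ⊆ T → T ⊆ c u → u ⊆ T.erase t ∧ T.erase t ⊆ (c u).erase t :=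
      fun u hu h1 h2 => ⟨fun z hz => Finset.mem_erase.2 ⟨fun e => hAt u hu (e ▸ hz), h1 hz⟩,
        Finset.erase_subset_erase t h2⟩
    obtain ⟨k1, k2⟩ := key u hu h1 h2
    obtain ⟨k1', k2'⟩ := key u' hu' h1' h2'
    have e1 : ((c u).erase t).card = d + 1 := by
      rw [Finset.card_erase_of_mem (htc u hu), hcd u hu]; rfl
    have e1' : ((c u').erase t).card = d + 1 := by
      rw [Finset.card_erase_of_mem (htc u' hu'), hcd u' hu']; rfl
    have l1 := Finset.card_le_card k1
    have l2 := Finset.card_le_card k2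
    have a1 := hAd u hu
    have a1' := hAd u' hu'
    by_cases hT : (T.erase t).card = d
    · rw [Finset.eq_of_subset_of_card_le k1 (by omega),
        Finset.eq_of_subset_of_card_le k1' (by omega)]
    · have q := Finset.eq_of_subset_of_card_le k2 (by omega)
      have q' := Finset.eq_of_subset_of_card_le k2' (by omega)
      refine hcinj u hu u' hu' ?_
      rw [← Finset.insert_erase (htc u hu), ← Finset.insert_erase (htc u' hu'), ← q, ← q']
  have hTP' : ∀ T ∈ P, T ∉ X → T ∈ P' := fun T hT hX => (hP' T).2 ⟨hT, fun u hu =>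
    ⟨fun e => hX ⟨u, hu, e.ge, e ▸ huc u hu⟩,
      fun e => hX ⟨u, hu, e ▸ Finset.subset_insert _ _, e ▸ hcsub u hu⟩⟩⟩
  let F : Finset (Finset α × Finset α) := Finset.univ.filter fun p =>
    (p.1 ∈ A ∧ p.2 = c p.1) ∨ (p ∈ F' ∧ p.1 ∉ X) ∨
    (p.1 = p.2 ∧ p.1 ∈ P ∧ p.1 ∉ X ∧ ∃ q ∈ F', q.1 ∈ X ∧ q.1 ⊆ p.1 ∧ p.1 ⊆ q.2)
  have hF : ∀ p, p ∈ F ↔ (p.1 ∈ A ∧ p.2 = c p.1) ∨ (p ∈ F' ∧ p.1 ∉ X) ∨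
    (p.1 = p.2 ∧ p.1 ∈ P ∧ p.1 ∉ X ∧ ∃ q ∈ F', q.1 ∈ X ∧ q.1 ⊆ p.1 ∧ p.1 ⊆ q.2) := by
    intro p; simp [F]
  refine ⟨F, ⟨?_, ?_⟩, ?_⟩
  · rintro ⟨a, b⟩ hp
    rcases (hF _).1 hp with ⟨h1, h2⟩ | ⟨h1, -⟩ | ⟨h1, h2, -⟩
    · simp only at h1 h2
      subst h2
      exact ⟨hAP a h1, hcP a h1, huc a h1⟩
    · obtain ⟨k1, k2, k3⟩ := hF'.1 _ h1
      exact ⟨((hP' _).1 k1).1, ((hP' _).1 k2).1, k3⟩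
    · simp only at h1 h2
      subst h1
      exact ⟨h2, h2, subset_rfl⟩
  · intro T hT
    by_cases hTX : T ∈ X
    · obtain ⟨u, hu, h1, h2⟩ := id hTX
      refine ⟨(u, c u), ⟨(hF _).2 (Or.inl ⟨hu, rfl⟩), h1, h2⟩, ?_⟩
      rintro ⟨a, b⟩ ⟨hp, h3, h4⟩
      simp only at h3 h4
      rcases (hF _).1 hp with ⟨ha, hb⟩ | ⟨ha, haX⟩ | ⟨hab, ha, haX, -⟩
      · simp only at ha hb
        subst hb
        rw [hdisj T a ha h3 h4 u hu h1 h2]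
      · exact absurd (hXcl a (hF'.1 _ ha).1 T hTX h3) haX
      · simp only at hab haX
        subst hab
        rw [subset_antisymm h3 h4] at haX
        exact absurd hTX haX
    · obtain ⟨q, ⟨hq, hq1, hq2⟩, hquniq⟩ := hF'.2 T (hTP' T hT hTX)
      by_cases hqX : q.1 ∈ X
      · refine ⟨(T, T), ⟨(hF _).2 (Or.inr (Or.inr ⟨rfl, hT, hTX, q, hq, hqX, hq1, hq2⟩)),
          subset_rfl, subset_rfl⟩, ?_⟩
        rintro ⟨a, b⟩ ⟨hp, h3, h4⟩
        simp only at h3 h4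
        rcases (hF _).1 hp with ⟨ha, hb⟩ | ⟨ha, haX⟩ | ⟨hab, -⟩
        · simp only at ha hb
          subst hb
          exact absurd ⟨a, ha, h3, h4⟩ hTX
        · have := hquniq (a, b) ⟨ha, h3, h4⟩
          subst this
          exact absurd hqX haX
        · simp only at hab
          subst hab
          rw [subset_antisymm h4 h3]
      · refine ⟨q, ⟨(hF _).2 (Or.inr (Or.inl ⟨hq, hqX⟩)), hq1, hq2⟩, ?_⟩
        rintro ⟨a, b⟩ ⟨hp, h3, h4⟩
        simp only at h3 h4
        rcases (hF _).1 hp with ⟨ha, hb⟩ | ⟨ha, haX⟩ | ⟨hab, -, -, r, hr, hrX, hr1, hr2⟩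
        · simp only at ha hb
          subst hb
          exact absurd ⟨a, ha, h3, h4⟩ hTX
        · exact hquniq (a, b) ⟨ha, h3, h4⟩
        · simp only at hab hr1 hr2
          subst hab
          rw [← subset_antisymm h4 h3] at hr1 hr2
          have := hquniq r ⟨hr, hr1, hr2⟩
          subst this
          exact absurd hrX hqX
  · rintro ⟨a, b⟩ hp
    rcases (hF _).1 hp with ⟨h1, h2⟩ | ⟨h1, -⟩ | ⟨h1, h2, h3, q, hq, hqX, hq1, hq2⟩
    · simp only at h1 h2 ⊢
      rw [h2, hcd a h1]
    · exact htop _ h1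
    · simp only at h1 h2 h3 hq1 hq2 ⊢
      subst h1
      have hlt : q.1.card < a.card :=
        Finset.card_lt_card (Finset.ssubset_iff_subset_ne.2 ⟨hq1, fun e => h3 (e ▸ hqX)⟩)
      rcases hcard' q.1 (hF'.1 q hq).1 with h | ⟨h, hn⟩
      · omega
      · obtain ⟨u, hu, h4, -⟩ := hqX
        have : u = q.1 := Finset.eq_of_subset_of_card_le h4 (by rw [hAd u hu, h])
        exact absurd (this ▸ hu) hn

end Partition

section Monomial

variable {K : Type*} [Field K] {n : ℕ}

/-- The exponent vector of the squarefree monomial with support `F`. -/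
noncomputable def sqExp (F : Finset (Fin n)) : Fin n →₀ ℕ := ∑ i ∈ F, Finsupp.single i 1

theorem sqExp_apply (F : Finset (Fin n)) (i : Fin n) : sqExp F i = if i ∈ F then 1 else 0 := by
  simp [sqExp, Finsupp.finsetSum_apply, Finsupp.single_apply]

theorem mem_support_sqExp {F : Finset (Fin n)} {i : Fin n} : i ∈ (sqExp F).support ↔ i ∈ F := by
  simp [sqExp_apply]

theorem support_sqExp (F : Finset (Fin n)) : (sqExp F).support = F :=
  Finset.ext fun _ => mem_support_sqExp

theorem sqExp_le_iff {F : Finset (Fin n)} {m : Fin n →₀ ℕ} : sqExp F ≤ m ↔ F ⊆ m.support := by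
  constructor
  · intro h i hi
    have := h i
    rw [sqExp_apply, if_pos hi] at this
    simp; omega
  · intro h i
    rw [sqExp_apply]
    split_ifs with hi
    · have := h hi
      simp at this; omega
    · simp

theorem sqExp_sub_single {F : Finset (Fin n)} {v : Fin n} :
    sqExp F - Finsupp.single v 1 = sqExp (F.erase v) := by
  ext i
  simp only [Finsupp.coe_tsub, Pi.sub_apply, sqExp_apply, Finsupp.single_apply, Finset.mem_erase]
  by_cases h : v = i
  · subst h; simp; split_ifs <;> rfl
  · simp [h, Ne.symm h]

theorem sqm_eq_monomial (F : Finset (Fin n)) : sqm K F = monomial (sqExp F) 1 := by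
  simp only [sqm, sqExp, X]
  induction F using Finset.induction_on with
  | empty => simp
  | insert i F hi ih => rw [Finset.prod_insert hi, ih, Finset.sum_insert hi, monomial_mul, one_mul]

theorem coeff_sqm_self (F : Finset (Fin n)) : coeff (sqExp F) (sqm K F) = 1 := by
  simp [sqm_eq_monomial]

theorem X_mul_sqm_erase {F : Finset (Fin n)} {v : Fin n} (hv : v ∈ F) :
    X v * sqm K (F.erase v) = sqm K F :=
  Finset.mul_prod_erase F _ hv

theorem coeff_sqExp_X_mul (G : Finset (Fin n)) (v : Fin n) (p : MvPolynomial (Fin n) K) :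
    coeff (sqExp G) (X v * p) = if v ∈ G then coeff (sqExp (G.erase v)) p else 0 := by
  rw [coeff_X_mul', support_sqExp, sqExp_sub_single]

theorem mem_span_sqm_iff {G : Set (Finset (Fin n))} {p : MvPolynomial (Fin n) K} :
    p ∈ Ideal.span (sqm K '' G) ↔ ∀ m ∈ p.support, ∃ T ∈ G, T ⊆ m.support := by
  have h : sqm K '' G = (fun s => monomial s (1 : K)) '' (sqExp '' G) := by
    rw [Set.image_image]
    exact Set.image_congr fun F _ => sqm_eq_monomial F
  rw [h, mem_ideal_span_monomial_image]
  simp [sqExp_le_iff]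

theorem sqm_mem_span_iff {G : Set (Finset (Fin n))} {T : Finset (Fin n)} :
    sqm K T ∈ Ideal.span (sqm K '' G) ↔ ∃ T' ∈ G, T' ⊆ T := by
  rw [mem_span_sqm_iff, sqm_eq_monomial]
  simp [support_sqExp]

theorem IsSqfreeMonomialIdeal.mem_iff {L : Ideal (MvPolynomial (Fin n) K)}
    (hL : IsSqfreeMonomialIdeal L) {p : MvPolynomial (Fin n) K} :
    p ∈ L ↔ ∀ m ∈ p.support, sqm K m.support ∈ L := by
  obtain ⟨G, rfl⟩ := hL
  rw [mem_span_sqm_iff]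
  simp only [sqm_mem_span_iff]

theorem sqm_mem_of_subset {L : Ideal (MvPolynomial (Fin n) K)} {T T' : Finset (Fin n)}
    (h : sqm K T ∈ L) (hs : T ⊆ T') : sqm K T' ∈ L := by
  rw [sqm, ← Finset.prod_sdiff hs]
  exact L.mul_mem_left _ h

theorem IsSqfreeMonomialIdeal.le_of_sqm {L L' : Ideal (MvPolynomial (Fin n) K)}
    (hL : IsSqfreeMonomialIdeal L) (h : ∀ T, sqm K T ∈ L → sqm K T ∈ L') : L ≤ L' := by
  obtain ⟨G, rfl⟩ := hL
  rw [Ideal.span_le]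
  rintro _ ⟨T, hT, rfl⟩
  exact h T (Ideal.subset_span ⟨T, hT, rfl⟩)

theorem IsSqfreeMonomialIdeal.coeff_eq_zero {L : Ideal (MvPolynomial (Fin n) K)}
    (hL : IsSqfreeMonomialIdeal L) {p : MvPolynomial (Fin n) K} (hp : p ∈ L)
    {T : Finset (Fin n)} (hT : sqm K T ∉ L) : coeff (sqExp T) p = 0 := by
  by_contra h
  have := hL.mem_iff.1 hp _ (mem_support_iff.2 h)
  rw [support_sqExp] at this
  exact hT this

theorem C_mul_sqm_mem {L : Ideal (MvPolynomial (Fin n) K)} {a : K} {F : Finset (Fin n)}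
    (h : a ≠ 0 → sqm K F ∈ L) : C a * sqm K F ∈ L := by
  by_cases ha : a = 0
  · simp [ha]
  · exact L.mul_mem_left _ (h ha)

theorem coeff_kdiff (h : Finset (Fin n) → MvPolynomial (Fin n) K) (F G : Finset (Fin n)) :
    coeff (sqExp G) (kdiff (X : Fin n → MvPolynomial (Fin n) K) h F) = ∑ v ∈ F, (ksign v F : K) *
      if v ∈ G then coeff (sqExp (G.erase v)) (h (F.erase v)) else 0 := by
  simp only [kdiff, coeff_sum]
  refine Finset.sum_congr rfl fun v _ => ?_
  rw [← coeff_sqExp_X_mul, zsmul_eq_mul, smul_eq_mul]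
  have : ((ksign v F : ℤ) : MvPolynomial (Fin n) K) = C (ksign v F : K) := by simp
  rw [this, coeff_C_mul]

theorem kdiff_C_mul_sqm (a : Finset (Fin n) → K) (F : Finset (Fin n)) :
    kdiff (X : Fin n → MvPolynomial (Fin n) K) (fun G => C (a G) * sqm K G) F =
      C (∑ v ∈ F, (ksign v F : K) * a (F.erase v)) * sqm K F := by
  simp only [kdiff, map_sum, Finset.sum_mul]
  refine Finset.sum_congr rfl fun v hv => ?_
  rw [← X_mul_sqm_erase hv, zsmul_eq_mul, smul_eq_mul, map_mul]
  have : ((ksign v F : ℤ) : MvPolynomial (Fin n) K) = C (ksign v F : K) := by simp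
  rw [this]
  ring

variable {I J : Ideal (MvPolynomial (Fin n) K)}

theorem KoszulVanishesBelow.exists_cochain {k : ℕ}
    (h : KoszulVanishesBelow (X : Fin n → MvPolynomial (Fin n) K) (quotMod I J) k) {j : ℕ}
    (hj : j < k) {g : Finset (Fin n) → MvPolynomial (Fin n) K} (hgI : ∀ F, g F ∈ I)
    (hg : ∀ F : Finset (Fin n), F.card = j + 1 →
      kdiff (X : Fin n → MvPolynomial (Fin n) K) g F ∈ J) :
    ∃ l : Finset (Fin n) → MvPolynomial (Fin n) K, (∀ F, l F ∈ I) ∧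
      ∀ F : Finset (Fin n), F.card = j →
        kdiff (X : Fin n → MvPolynomial (Fin n) K) l F - g F ∈ J := by
  let N := Submodule.comap I.subtype J
  have hcoe : ∀ (p : Finset (Fin n) → I) (F : Finset (Fin n)),
      ((kdiff (X : Fin n → MvPolynomial (Fin n) K) p F : I) : MvPolynomial (Fin n) K) =
        kdiff (X : Fin n → MvPolynomial (Fin n) K) (fun G => (p G : MvPolynomial (Fin n) K)) F :=
    fun p F => (kdiff_map X I.subtype p F).symm
  obtain ⟨l, hl⟩ := h j hj (fun F => N.mkQ ⟨g F, hgI F⟩) fun F hF => by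
    rw [kdiff_map X N.mkQ, Submodule.mkQ_apply, Submodule.Quotient.mk_eq_zero]
    change ((kdiff (X : Fin n → MvPolynomial (Fin n) K) _ F : I) : MvPolynomial (Fin n) K) ∈ J
    rw [hcoe]
    exact hg F hF
  choose s hs using N.mkQ_surjective
  refine ⟨fun F => s (l F), fun F => (s (l F)).2, fun F hF => ?_⟩
  have h1 := hl F hF
  have h2 : kdiff (X : Fin n → MvPolynomial (Fin n) K) l F =
      N.mkQ (kdiff (X : Fin n → MvPolynomial (Fin n) K) (fun G => s (l G)) F) := by
    rw [← kdiff_map]; simp only [hs]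
  rw [h2, Submodule.mkQ_apply, Submodule.mkQ_apply, Submodule.Quotient.eq] at h1
  have h3 : ((kdiff (X : Fin n → MvPolynomial (Fin n) K) (fun G => s (l G)) F - ⟨g F, hgI F⟩ : I) :
      MvPolynomial (Fin n) K) ∈ J := h1
  rwa [AddSubgroupClass.coe_sub, hcoe] at h3

open Classical in
theorem KoszulVanishesBelow.exists_matching (hI : IsSqfreeMonomialIdeal I)
    (hJ : IsSqfreeMonomialIdeal J) {k : ℕ} (hk : ∀ T, sqm K T ∈ I → k ≤ T.card)
    (h : KoszulVanishesBelow (X : Fin n → MvPolynomial (Fin n) K) (quotMod I J) (k + 1)) :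
    ∃ m : Finset (Fin n) → Finset (Fin n),
      (∀ u ∈ sqPoset I J, u.card = k → m u ∈ sqPoset I J ∧ u ⊆ m u ∧ (m u).card = k + 1) ∧
      ∀ u ∈ sqPoset I J, u.card = k → ∀ u' ∈ sqPoset I J, u'.card = k → m u = m u' → u = u' := by
  let ι := {u : Finset (Fin n) // u ∈ sqPoset I J ∧ u.card = k}
  let κ := {c : Finset (Fin n) // c ∈ sqPoset I J ∧ c.card = k + 1}
  let w : ι → κ → K := fun u c => ∑ v ∈ c.1, if c.1.erase v = u.1 then (ksign v c.1 : K) else 0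
  obtain ⟨m, hm, hmw⟩ := exists_injective_ne_zero_of_rows_independent w fun a ha => by
    let a' : Finset (Fin n) → K := fun F =>
      if hF : F ∈ sqPoset I J ∧ F.card = k then a ⟨F, hF⟩ else 0
    obtain ⟨l, hlI, hl⟩ := h.exists_cochain (Nat.lt_succ_self k)
      (g := fun F => C (a' F) * sqm K F)
      (fun F => C_mul_sqm_mem fun hF => by
        by_contra hFI
        exact hF (dif_neg fun h => hFI h.1.1))
      fun F hF => by
        rw [kdiff_C_mul_sqm]
        refine C_mul_sqm_mem fun hne => ?_
        by_contra hFJ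
        refine hne ?_
        by_cases hFI : sqm K F ∈ I
        · rw [← ha ⟨F, ⟨hFI, hFJ⟩, hF⟩]
          simp only [w, Finset.mul_sum]
          rw [Finset.sum_comm]
          refine Finset.sum_congr rfl fun v _ => ?_
          by_cases hv : F.erase v ∈ sqPoset I J ∧ (F.erase v).card = k
          · rw [Finset.sum_eq_single (⟨F.erase v, hv⟩ : ι)]
            · simp [a', hv, mul_comm]
            · intro u _ hu
              have : F.erase v ≠ u.1 := fun e => hu (Subtype.ext e.symm)
              simp [this]
            · simp
          · simp only [a', dif_neg hv, mul_zero]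
            refine (Finset.sum_eq_zero fun u _ => ?_).symm
            have : F.erase v ≠ u.1 := fun e => hv (e ▸ u.2)
            simp [this]
        · refine Finset.sum_eq_zero fun v _ => ?_
          have : ¬ (F.erase v ∈ sqPoset I J ∧ (F.erase v).card = k) := fun h' =>
            hFI (sqm_mem_of_subset h'.1.1 (Finset.erase_subset v F))
          simp [a', this]
    ext ⟨u, hu⟩
    have h1 := hJ.coeff_eq_zero (hl u hu.2) hu.1.2
    rw [coeff_sub, coeff_C_mul, coeff_sqm_self, coeff_kdiff, Finset.sum_eq_zero] at h1
    · simpa [a', hu] using h1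
    · intro v hv
      rw [if_pos hv, hI.coeff_eq_zero (hlI _), mul_zero]
      intro hmem
      have := hk _ hmem
      rw [Finset.card_erase_of_mem hv, hu.2] at this
      have := Finset.card_pos.2 ⟨v, hv⟩
      omega
  refine ⟨fun u => if hu : u ∈ sqPoset I J ∧ u.card = k then (m ⟨u, hu⟩).1 else ∅, ?_, ?_⟩
  · intro u hu huk
    have hu' : u ∈ sqPoset I J ∧ u.card = k := ⟨hu, huk⟩
    simp only [dif_pos hu']
    refine ⟨(m ⟨u, hu'⟩).2.1, ?_, (m ⟨u, hu'⟩).2.2⟩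
    obtain ⟨v, _, hv⟩ := Finset.exists_ne_zero_of_sum_ne_zero (hmw ⟨u, hu'⟩)
    have : (m ⟨u, hu'⟩).1.erase v = u := by
      by_contra hne
      exact hv (if_neg hne)
    exact this.ge.trans (Finset.erase_subset _ _)
  · intro u hu huk u' hu' huk' heq
    have h1 : u ∈ sqPoset I J ∧ u.card = k := ⟨hu, huk⟩
    have h2 : u' ∈ sqPoset I J ∧ u'.card = k := ⟨hu', huk'⟩
    simp only [dif_pos h1, dif_pos h2] at heq
    exact congrArg Subtype.val (hm (Subtype.ext heq))

end Monomial

section MatchingInsert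

variable {K : Type*} [Field K] {n : ℕ} {I J : Ideal (MvPolynomial (Fin n) K)}

theorem sum_ksign_mul_coeff_eq_zero (hI : IsSqfreeMonomialIdeal I) (hJ : IsSqfreeMonomialIdeal J)
    {d : ℕ} {t : Fin n} (hd : ∀ T, sqm K T ∈ I → d ≤ T.card)
    {l g : Finset (Fin n) → MvPolynomial (Fin n) K} {b : Finset (Fin n) → K}
    (hlI : ∀ F, l F ∈ I)
    (hg : ∀ F, g F = C (if t ∈ F then (ksign t F : K) * b (F.erase t) else 0) * sqm K (F.erase t))
    (hl : ∀ F : Finset (Fin n), F.card = d + 1 →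
      kdiff (X : Fin n → MvPolynomial (Fin n) K) l F - g F ∈ J)
    {u : Finset (Fin n)} (hu : u.card = d) (ht : t ∉ u) (huJ : sqm K u ∉ J) : b u = 0 := by
  have h1 := hJ.coeff_eq_zero (hl (insert t u) (by rw [Finset.card_insert_of_notMem ht, hu])) huJ
  rw [coeff_sub, coeff_kdiff, hg, if_pos (Finset.mem_insert_self t u), Finset.erase_insert ht,
    coeff_C_mul, coeff_sqm_self, mul_one, Finset.sum_eq_zero, zero_sub, neg_eq_zero] at h1
  · have h2 : (ksign t (insert t u) : K) * ksign t (insert t u) = 1 := by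
      rw [← Int.cast_mul, ksign_mul_self, Int.cast_one]
    rw [← one_mul (b u), ← h2, mul_assoc, h1, mul_zero]
  · intro v _
    split_ifs with hv
    · rw [hI.coeff_eq_zero (hlI _), mul_zero]
      intro hmem
      have := hd _ hmem
      rw [Finset.card_erase_of_mem hv, hu] at this
      have := Finset.card_pos.2 ⟨v, hv⟩
      omega
    · rw [mul_zero]

theorem kdiff_ksign_mul_sqm_erase (b : Finset (Fin n) → K) (t : Fin n) (F : Finset (Fin n)) :
    kdiff (X : Fin n → MvPolynomial (Fin n) K) (fun F =>
      C (if t ∈ F then (ksign t F : K) * b (F.erase t) else 0) * sqm K (F.erase t)) F =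
      C (if t ∈ F then
        -((ksign t F : K) * ∑ v ∈ F.erase t, (ksign v (F.erase t) : K) * b ((F.erase t).erase v))
        else 0) * sqm K (F.erase t) := by
  by_cases ht : t ∈ F
  · rw [if_pos ht, kdiff, ← Finset.add_sum_erase _ _ ht, if_neg (Finset.notMem_erase t F)]
    simp only [map_zero, zero_mul, smul_zero, zero_add, Finset.mul_sum, ← Finset.sum_neg_distrib]
    rw [map_sum, Finset.sum_mul]
    refine Finset.sum_congr rfl fun v hv => ?_
    obtain ⟨hvt, hvF⟩ := Finset.mem_erase.1 hv
    have hsw : (ksign v F : K) * ksign t (F.erase v) =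
        -((ksign t F : K) * ksign v (F.erase t)) := by
      exact_mod_cast congrArg (fun z : ℤ => (z : K)) (ksign_swap hvF ht hvt)
    rw [if_pos (Finset.mem_erase.2 ⟨hvt.symm, ht⟩), ← mul_assoc, ← neg_mul, ← hsw,
      Finset.erase_right_comm, ← X_mul_sqm_erase hv, zsmul_eq_mul, smul_eq_mul, mul_assoc, map_mul,
      map_mul, map_mul]
    have : ((ksign v F : ℤ) : MvPolynomial (Fin n) K) = C (ksign v F : K) := by simp
    rw [this]
    ring
  · rw [if_neg ht, map_zero, zero_mul, kdiff]
    refine Finset.sum_eq_zero fun v _ => ?_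
    rw [if_neg fun h => ht (Finset.mem_of_mem_erase h)]
    simp

open Classical in
theorem KoszulVanishesBelow.exists_matching_insert (hI : IsSqfreeMonomialIdeal I)
    (hJ : IsSqfreeMonomialIdeal J) {d : ℕ} {t : Fin n} (hd : ∀ T, sqm K T ∈ I → d ≤ T.card)
    (ht : ∀ T, sqm K T ∈ I → T.card = d → t ∉ T)
    (h : KoszulVanishesBelow (X : Fin n → MvPolynomial (Fin n) K) (quotMod I J) (d + 2))
    {A : Set (Finset (Fin n))}
    (hA : ∀ u ∈ A, sqm K u ∈ I ∧ u.card = d ∧ sqm K (insert t u) ∉ J) :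
    ∃ c : Finset (Fin n) → Finset (Fin n),
      (∀ u ∈ A, c u ∈ sqPoset I J ∧ insert t u ⊆ c u ∧ (c u).card = d + 2) ∧
      ∀ u ∈ A, ∀ u' ∈ A, c u = c u' → u = u' := by
  have htA : ∀ u ∈ A, t ∉ u := fun u hu => ht u (hA u hu).1 (hA u hu).2.1
  let κ := {c : Finset (Fin n) // c ∈ sqPoset I J ∧ c.card = d + 2}
  let w : A → κ → K := fun u c =>
    ∑ v ∈ c.1, if c.1.erase v = insert t u.1 then (ksign v c.1 : K) else 0
  obtain ⟨m, hm, hmw⟩ := exists_injective_ne_zero_of_rows_independent w fun a ha => by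
    let a' : Finset (Fin n) → K := fun F =>
      if hF : t ∈ F ∧ F.erase t ∈ A then a ⟨F.erase t, hF.2⟩ else 0
    obtain ⟨l, hlI, hl⟩ := h.exists_cochain (Nat.lt_succ_self (d + 1))
      (g := fun F => C (a' F) * sqm K F)
      (fun F => C_mul_sqm_mem fun hF => by
        by_contra hFI
        exact hF (dif_neg fun h =>
          hFI (sqm_mem_of_subset (hA _ h.2).1 (Finset.erase_subset t F))))
      fun F hF => by
        rw [kdiff_C_mul_sqm]
        refine C_mul_sqm_mem fun hne => ?_
        by_contra hFJ
        refine hne ?_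
        by_cases hFI : sqm K F ∈ I
        · rw [← ha ⟨F, ⟨hFI, hFJ⟩, hF⟩]
          simp only [w, Finset.mul_sum]
          rw [Finset.sum_comm]
          refine Finset.sum_congr rfl fun v _ => ?_
          by_cases hv : t ∈ F.erase v ∧ (F.erase v).erase t ∈ A
          · rw [Finset.sum_eq_single (⟨(F.erase v).erase t, hv.2⟩ : A)]
            · simp only [a', dif_pos hv, Finset.insert_erase hv.1, if_true, mul_comm]
            · intro u _ hu
              have : F.erase v ≠ insert t u.1 := fun e => hu (Subtype.ext (by
                simp only [e, Finset.erase_insert (htA u.1 u.2)]))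
              simp [this]
            · simp
          · simp only [a', dif_neg hv, mul_zero]
            refine (Finset.sum_eq_zero fun u _ => ?_).symm
            have : F.erase v ≠ insert t u.1 := fun e => hv (by
              rw [e, Finset.erase_insert (htA u.1 u.2)]
              exact ⟨Finset.mem_insert_self _ _, u.2⟩)
            simp [this]
        · refine Finset.sum_eq_zero fun v _ => ?_
          have : ¬ (t ∈ F.erase v ∧ (F.erase v).erase t ∈ A) := fun h' =>
            hFI (sqm_mem_of_subset (hA _ h'.2).1
              ((Finset.erase_subset _ _).trans (Finset.erase_subset _ _)))
          simp only [a', dif_neg this, mul_zero]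
    obtain ⟨l', hlI', hl'⟩ := h.exists_cochain (Nat.lt_succ_self (d + 1))
      (g := fun F => C (if t ∈ F then (ksign t F : K) * coeff (sqExp (F.erase t)) (l (F.erase t))
        else 0) * sqm K (F.erase t))
      (fun F => C_mul_sqm_mem fun hF => by
        by_contra hFI
        exact hF (by simp [hI.coeff_eq_zero (hlI _) hFI]))
      fun F hF => by
        rw [kdiff_ksign_mul_sqm_erase (fun G => coeff (sqExp G) (l G))]
        refine C_mul_sqm_mem fun hne => ?_
        by_contra hFJ
        refine hne ?_
        split_ifs with htF
        · have h1 := hJ.coeff_eq_zero (hl (F.erase t)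
            (by rw [Finset.card_erase_of_mem htF, hF]; rfl)) hFJ
          have h2 : a' (F.erase t) = 0 := dif_neg fun h => Finset.notMem_erase t F h.1
          rw [coeff_sub, h2, map_zero, zero_mul, coeff_zero, sub_zero, coeff_kdiff] at h1
          rw [← h1.symm.trans (Finset.sum_congr rfl fun v hv => by rw [if_pos hv]), mul_zero,
            neg_zero]
        · rfl
    ext ⟨u, hu⟩
    obtain ⟨huI, hud, huJ⟩ := hA u hu
    have hb := sum_ksign_mul_coeff_eq_zero (b := fun G => coeff (sqExp G) (l G)) hI hJ hd hlI'
      (fun F => rfl) hl' hud (htA u hu)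
      (fun h => huJ (sqm_mem_of_subset h (Finset.subset_insert t u)))
    have hcard : (insert t u).card = d + 1 := by
      rw [Finset.card_insert_of_notMem (htA u hu), hud]
    have h1 := hJ.coeff_eq_zero (hl (insert t u) hcard) huJ
    rw [coeff_sub, coeff_C_mul, coeff_sqm_self, coeff_kdiff, Finset.sum_eq_zero] at h1
    · simpa [a', htA u hu, hu] using h1
    · intro v hv
      rw [if_pos hv]
      by_cases hvt : v = t
      · subst hvt
        rw [Finset.erase_insert (htA u hu), hb, mul_zero]
      · rw [hI.coeff_eq_zero (hlI _), mul_zero]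
        intro hmem
        exact ht _ hmem (by rw [Finset.card_erase_of_mem hv, hcard]; rfl)
          (Finset.mem_erase.2 ⟨Ne.symm hvt, Finset.mem_insert_self t u⟩)
  refine ⟨fun u => if hu : u ∈ A then (m ⟨u, hu⟩).1 else ∅, ?_, ?_⟩
  · intro u hu
    simp only [dif_pos hu]
    refine ⟨(m ⟨u, hu⟩).2.1, ?_, (m ⟨u, hu⟩).2.2⟩
    obtain ⟨v, _, hv⟩ := Finset.exists_ne_zero_of_sum_ne_zero (hmw ⟨u, hu⟩)
    have : (m ⟨u, hu⟩).1.erase v = insert t u := by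
      by_contra hne
      exact hv (if_neg hne)
    exact this.ge.trans (Finset.erase_subset _ _)
  · intro u hu u' hu' heq
    simp only [dif_pos hu, dif_pos hu'] at heq
    exact congrArg Subtype.val (hm (Subtype.ext heq))

end MatchingInsert

section Peeling

variable {K : Type*} [Field K] {n : ℕ}

theorem X_mul_mem_span_X_image {s : Set (Fin n)} {v : Fin n} (hv : v ∉ s)
    {p : MvPolynomial (Fin n) K}
    (h : X v * p ∈ Ideal.span (X '' s : Set (MvPolynomial (Fin n) K))) :
    p ∈ Ideal.span (X '' s : Set (MvPolynomial (Fin n) K)) := by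
  rw [mem_ideal_span_X_image] at h ⊢
  intro m hm
  obtain ⟨i, hi, hne⟩ := h (Finsupp.single v 1 + m) (by
    rw [mem_support_iff, coeff_X_mul]; exact mem_support_iff.1 hm)
  have hvi : v ≠ i := fun e => hv (e ▸ hi)
  exact ⟨i, hi, by simpa [hvi] using hne⟩

theorem koszulVanishesBelow_quot_span_X (V : Finset (Fin n)) :
    KoszulVanishesBelow (X : Fin n → MvPolynomial (Fin n) K)
      (MvPolynomial (Fin n) K ⧸
        Ideal.span (X '' (↑V : Set (Fin n))ᶜ : Set (MvPolynomial (Fin n) K)))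
      V.card := by
  induction V using Finset.induction_on with
  | empty => exact fun j hj => absurd hj (Nat.not_lt_zero j)
  | insert v V hv ih =>
    have hVc : ((↑V : Set (Fin n))ᶜ) = insert v (↑(insert v V) : Set (Fin n))ᶜ := by
      ext i
      by_cases hi : i = v
      · simp [hi, hv]
      · simp [hi]
    have hle : Ideal.span (X '' (↑(insert v V) : Set (Fin n))ᶜ : Set (MvPolynomial (Fin n) K)) ≤
        Ideal.span (X '' (↑V : Set (Fin n))ᶜ) := by
      rw [hVc]
      exact Ideal.span_mono (Set.image_mono (Set.subset_insert _ _))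
    rw [Finset.card_insert_of_notMem hv]
    refine KoszulVanishesBelow.of_regular (β := Submodule.factor hle) (y := X v)
      (Ideal.subset_span ⟨v, rfl⟩) ?_ (Submodule.factor_surjective hle) ?_ ih
    · rw [isSMulRegular_iff_right_eq_zero_of_smul]
      intro q
      obtain ⟨p, rfl⟩ := Submodule.Quotient.mk_surjective _ q
      rw [← Submodule.Quotient.mk_smul, Submodule.Quotient.mk_eq_zero,
        Submodule.Quotient.mk_eq_zero]
      exact X_mul_mem_span_X_image (by simp)
    · intro q
      obtain ⟨p, rfl⟩ := Submodule.Quotient.mk_surjective _ q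
      constructor
      · intro h
        have h' : p ∈ Ideal.span (X '' (↑V : Set (Fin n))ᶜ : Set (MvPolynomial (Fin n) K)) :=
          (Submodule.Quotient.mk_eq_zero _).1 h
        rw [hVc, Set.image_insert_eq, Ideal.mem_span_insert] at h'
        obtain ⟨a, z, hz, rfl⟩ := h'
        refine ⟨Submodule.Quotient.mk a, ?_⟩
        rw [LinearMap.lsmul_apply, ← Submodule.Quotient.mk_smul, Submodule.Quotient.eq]
        have : (X v : MvPolynomial (Fin n) K) • a - (a * X v + z) = -z := by rw [smul_eq_mul]; ring
        rw [this]
        exact neg_mem hz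
      · rintro ⟨q, hq⟩
        obtain ⟨a, rfl⟩ := Submodule.Quotient.mk_surjective _ q
        rw [← hq, LinearMap.lsmul_apply, map_smul]
        change (Submodule.Quotient.mk (X v • a) : MvPolynomial (Fin n) K ⧸ _) = 0
        rw [Submodule.Quotient.mk_eq_zero, smul_eq_mul]
        refine Ideal.mul_mem_right _ _ (Ideal.subset_span ⟨v, ?_, rfl⟩)
        simpa using hv

variable {I I' J : Ideal (MvPolynomial (Fin n) K)}

theorem mul_sqm_mem_iff (hI' : IsSqfreeMonomialIdeal I') {u V : Finset (Fin n)}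
    (h : ∀ T, sqm K (T ∪ u) ∈ I' ↔ ¬ T ⊆ V) (p : MvPolynomial (Fin n) K) :
    p * sqm K u ∈ I' ↔
      p ∈ Ideal.span (X '' (↑V : Set (Fin n))ᶜ : Set (MvPolynomial (Fin n) K)) := by
  have key : ∀ m : Fin n →₀ ℕ, (∃ i ∈ (↑V : Set (Fin n))ᶜ, m i ≠ 0) ↔
      sqm K ((m + sqExp u).support) ∈ I' := fun m => by
    rw [Finsupp.support_add_eq_union, support_sqExp, h, Finset.not_subset]
    simp [and_comm]
  rw [hI'.mem_iff, mem_ideal_span_X_image]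
  simp only [key, sqm_eq_monomial u]
  constructor
  · intro H m hm
    refine H _ ?_
    rw [mem_support_iff, coeff_mul_monomial, mul_one]
    exact mem_support_iff.1 hm
  · intro H m hm
    rw [mem_support_iff, coeff_mul_monomial'] at hm
    split_ifs at hm with hle
    · have := H (m - sqExp u) (mem_support_iff.2 (by simpa using hm))
      rwa [tsub_add_cancel_of_le hle] at this
    · exact absurd rfl hm

theorem koszulVanishesBelow_quotMod_of_insert (hI : IsSqfreeMonomialIdeal I)
    (hI' : IsSqfreeMonomialIdeal I') {u : Finset (Fin n)} {t : Fin n} (ht : t ∉ u)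
    (huI : sqm K u ∈ I) (htu : sqm K (insert t u) ∉ I')
    (h : ∀ T, sqm K T ∈ I → sqm K T ∈ I' ∨ T = u ∨ T = insert t u) :
    KoszulVanishesBelow (X : Fin n → MvPolynomial (Fin n) K) (quotMod I I') (u.card + 1) := by
  let φ : MvPolynomial (Fin n) K →ₗ[MvPolynomial (Fin n) K] quotMod I I' :=
    (Submodule.mkQ _).comp (LinearMap.toSpanSingleton _ I ⟨sqm K u, huI⟩)
  have hφ : Function.Surjective φ := by
    intro q
    obtain ⟨⟨q, hq⟩, rfl⟩ := Submodule.Quotient.mk_surjective _ q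
    have hsup : I ≤ I' ⊔ Ideal.span {sqm K u} := by
      refine hI.le_of_sqm fun T hT => ?_
      have hmem : sqm K u ∈ I' ⊔ Ideal.span {sqm K u} :=
        (le_sup_right : Ideal.span {sqm K u} ≤ _) (Ideal.mem_span_singleton_self _)
      rcases h T hT with h1 | rfl | rfl
      · exact (le_sup_left : I' ≤ _) h1
      · exact hmem
      · exact sqm_mem_of_subset hmem (Finset.subset_insert t u)
    obtain ⟨a, ha, b, hb, rfl⟩ := Submodule.mem_sup.1 (hsup hq)
    obtain ⟨c, rfl⟩ := Ideal.mem_span_singleton'.1 hb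
    refine ⟨c, ?_⟩
    simp only [φ, LinearMap.comp_apply, Submodule.mkQ_apply, LinearMap.toSpanSingleton_apply]
    rw [Submodule.Quotient.eq]
    change c * sqm K u - (a + c * sqm K u) ∈ I'
    rw [sub_add_cancel_right]
    exact neg_mem ha
  have hker : LinearMap.ker φ =
      Ideal.span (X '' (↑(insert t u) : Set (Fin n))ᶜ : Set (MvPolynomial (Fin n) K)) := by
    ext p
    rw [LinearMap.mem_ker, ← mul_sqm_mem_iff hI' (u := u)]
    · simp only [φ, LinearMap.comp_apply, Submodule.mkQ_apply, LinearMap.toSpanSingleton_apply]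
      rw [Submodule.Quotient.mk_eq_zero]
      rfl
    · intro T
      constructor
      · intro hT hTV
        exact htu (sqm_mem_of_subset hT (Finset.union_subset hTV (Finset.subset_insert t u)))
      · intro hTV
        rcases h (T ∪ u) (sqm_mem_of_subset huI Finset.subset_union_right) with h1 | h1 | h1
        · exact h1
        · exact absurd ((Finset.subset_union_left.trans h1.le).trans (Finset.subset_insert t u)) hTV
        · exact absurd (Finset.subset_union_left.trans h1.le) hTV
  rw [← Finset.card_insert_of_notMem ht]
  exact (koszulVanishesBelow_quot_span_X (insert t u)).congr
    ((Submodule.quotEquivOfEq _ _ hker.symm).trans (φ.quotKerEquivOfSurjective hφ))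

theorem KoszulVanishesBelow.quotMod_of_le {k : ℕ} (hle : I' ≤ I) (hJ : J ≤ I')
    (h : KoszulVanishesBelow (X : Fin n → MvPolynomial (Fin n) K) (quotMod I J) (k + 1))
    (h' : KoszulVanishesBelow (X : Fin n → MvPolynomial (Fin n) K) (quotMod I I') k) :
    KoszulVanishesBelow (X : Fin n → MvPolynomial (Fin n) K) (quotMod I' J) (k + 1) := by
  let α : quotMod I' J →ₗ[MvPolynomial (Fin n) K] quotMod I J :=
    Submodule.mapQ _ _ (Submodule.inclusion hle) fun _ hx => hx
  let β : quotMod I J →ₗ[MvPolynomial (Fin n) K] quotMod I I' :=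
    Submodule.factor (Submodule.comap_mono hJ)
  refine KoszulVanishesBelow.left_of_exact (α := α) (β := β) ?_
    (Submodule.factor_surjective _) ?_ h h'
  · rw [injective_iff_map_eq_zero]
    intro q hq
    obtain ⟨p, rfl⟩ := Submodule.Quotient.mk_surjective _ q
    have hp : (p : MvPolynomial (Fin n) K) ∈ J :=
      (Submodule.Quotient.mk_eq_zero (Submodule.comap I.subtype J)).1 hq
    exact (Submodule.Quotient.mk_eq_zero _).2 hp
  · intro q
    obtain ⟨p, rfl⟩ := Submodule.Quotient.mk_surjective _ q
    constructor
    · intro hq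
      have hp : (p : MvPolynomial (Fin n) K) ∈ I' :=
        (Submodule.Quotient.mk_eq_zero (Submodule.comap I.subtype I')).1 hq
      exact ⟨Submodule.Quotient.mk ⟨p, hp⟩, rfl⟩
    · rintro ⟨q, hq⟩
      obtain ⟨a, rfl⟩ := Submodule.Quotient.mk_surjective _ q
      rw [← hq]
      exact (Submodule.Quotient.mk_eq_zero _).2 a.2

end Peeling

section Peel

variable {K : Type*} [Field K] {n : ℕ} {I J : Ideal (MvPolynomial (Fin n) K)}

/-- The ideal generated by the squarefree monomials of `I` other than those with support `u` or
`insert t u`, for `u` in `A`. -/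
noncomputable def peelIdeal (I : Ideal (MvPolynomial (Fin n) K)) (t : Fin n)
    (A : Finset (Finset (Fin n))) :
    Ideal (MvPolynomial (Fin n) K) :=
  Ideal.span (sqm K '' {T | sqm K T ∈ I ∧ ∀ u ∈ A, T ≠ u ∧ T ≠ insert t u})

variable {d : ℕ} {t : Fin n} {A : Finset (Finset (Fin n))}

theorem isSqfreeMonomialIdeal_peelIdeal : IsSqfreeMonomialIdeal (peelIdeal I t A) := ⟨_, rfl⟩

theorem sqm_mem_peelIdeal_iff (hd : ∀ T, sqm K T ∈ I → d ≤ T.card)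
    (ht : ∀ T, sqm K T ∈ I → T.card = d → t ∉ T) (hA : ∀ u ∈ A, u.card = d) {T : Finset (Fin n)} :
    sqm K T ∈ peelIdeal I t A ↔ sqm K T ∈ I ∧ ∀ u ∈ A, T ≠ u ∧ T ≠ insert t u := by
  rw [peelIdeal, sqm_mem_span_iff]
  refine ⟨?_, fun h => ⟨T, h, subset_rfl⟩⟩
  rintro ⟨T', ⟨hT', hne⟩, hs⟩
  refine ⟨sqm_mem_of_subset hT' hs, fun u hu => ⟨?_, ?_⟩⟩
  · rintro rfl
    exact (hne T hu).1 (Finset.eq_of_subset_of_card_le hs ((hA T hu).trans_le (hd T' hT')))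
  · rintro rfl
    by_cases h : T'.card = d
    · refine (hne u hu).1 (Finset.eq_of_subset_of_card_le ?_ ((hA u hu).trans_le h.ge))
      exact (Finset.subset_insert_iff_of_notMem (ht T' hT' h)).1 hs
    · refine (hne u hu).2 (Finset.eq_of_subset_of_card_le hs ((Finset.card_insert_le t u).trans ?_))
      have h1 := hd T' hT'
      have h2 := hA u hu
      omega

theorem le_peelIdeal (hd : ∀ T, sqm K T ∈ I → d ≤ T.card)
    (ht : ∀ T, sqm K T ∈ I → T.card = d → t ∉ T) (hJ : IsSqfreeMonomialIdeal J) (hJI : J ≤ I)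
    (hA : ∀ u ∈ A, u.card = d ∧ sqm K (insert t u) ∉ J) : J ≤ peelIdeal I t A := by
  refine hJ.le_of_sqm fun T hT => (sqm_mem_peelIdeal_iff hd ht fun u hu => (hA u hu).1).2
    ⟨hJI hT, fun u hu => ⟨?_, ?_⟩⟩
  · rintro rfl
    exact (hA T hu).2 (sqm_mem_of_subset hT (Finset.subset_insert t T))
  · rintro rfl
    exact (hA u hu).2 hT

theorem KoszulVanishesBelow.quotMod_peelIdeal (hI : IsSqfreeMonomialIdeal I)
    (hJ : IsSqfreeMonomialIdeal J)
    (hJI : J ≤ I) (hd : ∀ T, sqm K T ∈ I → d ≤ T.card)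
    (ht : ∀ T, sqm K T ∈ I → T.card = d → t ∉ T)
    (hA : ∀ u ∈ A, sqm K u ∈ I ∧ u.card = d ∧ sqm K (insert t u) ∉ J)
    (h : KoszulVanishesBelow (X : Fin n → MvPolynomial (Fin n) K) (quotMod I J) (d + 2)) :
    KoszulVanishesBelow (X : Fin n → MvPolynomial (Fin n) K) (quotMod (peelIdeal I t A) J)
      (d + 2) := by
  induction A using Finset.induction_on with
  | empty =>
    have : peelIdeal I t ∅ = I := by
      refine le_antisymm (isSqfreeMonomialIdeal_peelIdeal.le_of_sqm fun T hT => ?_)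
        (hI.le_of_sqm fun T hT => ?_)
      · exact ((sqm_mem_peelIdeal_iff hd ht (by simp)).1 hT).1
      · exact (sqm_mem_peelIdeal_iff hd ht (by simp)).2 ⟨hT, by simp⟩
    rwa [this]
  | insert u A hu ih =>
    have hA' : ∀ v ∈ A, sqm K v ∈ I ∧ v.card = d ∧ sqm K (insert t v) ∉ J :=
      fun v hv => hA v (Finset.mem_insert_of_mem hv)
    obtain ⟨huI, hud, huJ⟩ := hA u (Finset.mem_insert_self u A)
    have mem := fun T => sqm_mem_peelIdeal_iff (T := T) hd ht fun v hv => (hA' v hv).2.1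
    have mem' := fun T => sqm_mem_peelIdeal_iff (T := T) hd ht fun v hv => (hA v hv).2.1
    have htu := ht u huI hud
    refine KoszulVanishesBelow.quotMod_of_le (I := peelIdeal I t A) ?_
      (le_peelIdeal hd ht hJ hJI fun v hv => (hA v hv).2) (ih hA') ?_
    · refine isSqfreeMonomialIdeal_peelIdeal.le_of_sqm fun T hT => ?_
      rw [mem'] at hT
      exact (mem T).2 ⟨hT.1, fun v hv => hT.2 v (Finset.mem_insert_of_mem hv)⟩
    · rw [← hud]
      refine koszulVanishesBelow_quotMod_of_insert isSqfreeMonomialIdeal_peelIdeal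
        isSqfreeMonomialIdeal_peelIdeal htu ?_ ?_ ?_
      · refine (mem u).2 ⟨huI, fun v hv => ⟨?_, ?_⟩⟩
        · rintro rfl
          exact hu hv
        · rintro rfl
          exact htu (Finset.mem_insert_self t v)
      · intro h
        exact ((mem' _).1 h).2 u (Finset.mem_insert_self u A) |>.2 rfl
      · intro T hT
        by_cases h1 : T = u
        · exact Or.inr (Or.inl h1)
        by_cases h2 : T = insert t u
        · exact Or.inr (Or.inr h2)
        rw [mem] at hT
        refine Or.inl ((mem' T).2 ⟨hT.1, fun v hv => ?_⟩)
        rcases Finset.mem_insert.1 hv with rfl | hv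
        · exact ⟨h1, h2⟩
        · exact hT.2 v hv

end Peel

section Bounds

variable {K : Type*} [Field K] {n : ℕ} {I J : Ideal (MvPolynomial (Fin n) K)}

theorem koszulVanishesBelow_of_lt_depthIJ {k : ℕ} (h : k < depthIJ I J) :
    KoszulVanishesBelow (X : Fin n → MvPolynomial (Fin n) K) (quotMod I J) (k + 1) := by
  by_contra hk
  refine h.not_ge (csSup_le' ?_)
  rintro _ ⟨rs, rfl, hrs, hreg⟩
  by_contra hlt
  exact hk ((KoszulVanishesBelow.of_isWeaklyRegular hrs hreg.toIsWeaklyRegular).mono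
    (not_le.1 hlt))

theorem span_X_smul_quotMod_ne_top (hJ : IsSqfreeMonomialIdeal J) (hI : IsSqfreeMonomialIdeal I)
    {u : Finset (Fin n)} (hu : u ∈ sqPoset I J) (hmin : ∀ T, sqm K T ∈ I → u.card ≤ T.card) :
    Ideal.span (Set.range (X : Fin n → MvPolynomial (Fin n) K)) •
      (⊤ : Submodule (MvPolynomial (Fin n) K) (quotMod I J)) ≠ ⊤ := by
  intro htop
  have key : ∀ r ∈ Ideal.span (Set.range (X : Fin n → MvPolynomial (Fin n) K)), ∀ p ∈ I,
      coeff (sqExp u) (r * p) = 0 := by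
    intro r hr
    induction hr using Submodule.span_induction with
    | mem r hr =>
      obtain ⟨v, rfl⟩ := hr
      intro p hp
      rw [coeff_sqExp_X_mul]
      split_ifs with hv
      · refine hI.coeff_eq_zero hp fun hmem => ?_
        exact (hmin _ hmem).not_gt (Finset.card_erase_lt_of_mem hv)
      · rfl
    | zero => simp
    | add a b _ _ iha ihb =>
      intro p hp
      rw [add_mul, coeff_add, iha p hp, ihb p hp, add_zero]
    | smul a b _ ih =>
      intro p hp
      rw [smul_eq_mul, mul_comm a b, mul_assoc]
      exact ih _ (I.mul_mem_left a hp)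
  have hall : ∀ q ∈ Ideal.span (Set.range (X : Fin n → MvPolynomial (Fin n) K)) •
      (⊤ : Submodule (MvPolynomial (Fin n) K) (quotMod I J)),
      ∃ p : I, coeff (sqExp u) (p : MvPolynomial (Fin n) K) = 0 ∧ Submodule.Quotient.mk p = q := by
    intro q hq
    refine Submodule.smul_induction_on hq (fun r hr q _ => ?_) fun a b iha ihb => ?_
    · obtain ⟨p, rfl⟩ := Submodule.Quotient.mk_surjective _ q
      exact ⟨r • p, key r hr p p.2, rfl⟩
    · obtain ⟨p, hp, rfl⟩ := iha
      obtain ⟨p', hp', rfl⟩ := ihb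
      exact ⟨p + p', by simp [hp, hp'], rfl⟩
  obtain ⟨p, hp, hpq⟩ := hall (Submodule.Quotient.mk ⟨sqm K u, hu.1⟩) (by rw [htop]; trivial)
  rw [Submodule.Quotient.eq] at hpq
  have h1 : (p : MvPolynomial (Fin n) K) - sqm K u ∈ J := hpq
  have := hJ.coeff_eq_zero h1 hu.2
  rw [coeff_sub, hp, coeff_sqm_self] at this
  simp at this

theorem KoszulVanishesBelow.le_depthIJ {k : ℕ} (hI : IsSqfreeMonomialIdeal I)
    (hJ : IsSqfreeMonomialIdeal J) {u : Finset (Fin n)} (hu : u ∈ sqPoset I J)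
    (hmin : ∀ T, sqm K T ∈ I → u.card ≤ T.card)
    (h : KoszulVanishesBelow (X : Fin n → MvPolynomial (Fin n) K) (quotMod I J) k) :
    k ≤ depthIJ I J := by
  have hM := span_X_smul_quotMod_ne_top hJ hI hu hmin
  refine le_csSup ⟨n, ?_⟩ (h.exists_isRegular hM)
  rintro _ ⟨rs, rfl, hrs, hreg⟩
  simpa using (KoszulVanishesBelow.of_isWeaklyRegular hrs hreg.toIsWeaklyRegular).le_card hM

theorem bddAbove_intervalPartition {u : Finset (Fin n)} (hu : u ∈ sqPoset I J) :
    BddAbove {k | ∃ F, IsIntervalPartition I J F ∧ ∀ p ∈ F, k ≤ p.2.card} := by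
  refine ⟨n, ?_⟩
  rintro k ⟨F, hF, hk⟩
  obtain ⟨p, ⟨hp, -⟩, -⟩ := hF.2 u hu
  exact (hk p hp).trans (card_finset_fin_le p.2)

theorem le_sdepth {u : Finset (Fin n)} (hu : u ∈ sqPoset I J) {k : ℕ}
    (h : ∃ F, IsIntervalPartition I J F ∧ ∀ p ∈ F, k ≤ p.2.card) : k ≤ sdepth I J :=
  le_csSup (bddAbove_intervalPartition hu) h

theorem exists_intervalPartition_of_le_sdepth {u : Finset (Fin n)} (hu : u ∈ sqPoset I J) {k : ℕ}
    (hk : 0 < k) (h : k ≤ sdepth I J) :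
    ∃ F, IsIntervalPartition I J F ∧ ∀ p ∈ F, k ≤ p.2.card := by
  obtain ⟨F, hF, hF'⟩ := Nat.sSup_mem (Set.nonempty_iff_ne_empty.2 fun h0 => by
      rw [sdepth, h0, csSup_empty, bot_eq_zero] at h; omega)
    (bddAbove_intervalPartition hu)
  exact ⟨F, hF, fun p hp => h.trans (hF' p hp)⟩

theorem IsSqfreeMonomialIdeal.exists_minimal_generators (hI : IsSqfreeMonomialIdeal I)
    {E : Set (Finset (Fin n))} (hE : ∀ T, T ∈ E ↔ Minimal (fun T => sqm K T ∈ I) T) :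
    I = Ideal.span (sqm K '' E) ∧ ∀ g ∈ E, sqm K g ∉ Ideal.span (sqm K '' (E \ {g})) := by
  refine ⟨le_antisymm (hI.le_of_sqm fun T hT => ?_) ?_, fun g hg hmem => ?_⟩
  · obtain ⟨T', hT', hmin⟩ := exists_minimal_le_of_wellFoundedLT (fun T => sqm K T ∈ I) T hT
    exact sqm_mem_span_iff.2 ⟨T', (hE T').2 hmin, hT'⟩
  · rw [Ideal.span_le]
    rintro _ ⟨T, hT, rfl⟩
    exact ((hE T).1 hT).prop
  · obtain ⟨T, ⟨hT, hne⟩, hs⟩ := sqm_mem_span_iff.1 hmem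
    exact hne (((hE g).1 hg).eq_of_le ((hE T).1 hT).prop hs)

end Bounds

/-- if Conjecture `c` holds for all `r' < r` (over any polynomial ring
over `K`), `I` is minimally generated by `r` squarefree monomials of degree `d`,
some `c ∈ C` has support not inside the union of the supports of the generators,
and `sdepth I/J = d+1`, then `depth I/J ≤ d+1`. -/
theorem statement2 {K : Type*} [Field K] {n : ℕ} (d r : ℕ) (hd : 0 < d) (hr : 0 < r)
    (I J : Ideal (MvPolynomial (Fin n) K)) (hJI : J < I)
    (f : Fin r → Finset (Fin n)) (hfinj : Function.Injective f)
    (hfd : ∀ i, (f i).card = d)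
    (hI : I = Ideal.span (sqm K '' Set.range f))
    (hmin : ∀ g ∈ Set.range f,
      sqm K g ∉ Ideal.span (sqm K '' (Set.range f \ {g})))
    (hJ : SqfreeGenFrom J (d + 1))
    (hc : ∃ c ∈ degSet I J (d + 2), ¬ c ⊆ Finset.univ.sup f)
    (hind : ∀ r' : ℕ, r' < r → 0 < r' → ∀ n' : ℕ,
      ∀ I' J' : Ideal (MvPolynomial (Fin n') K), J' < I' →
      ∀ f' : Fin r' → Finset (Fin n'), Function.Injective f' →
      (∀ i, (f' i).card = d) →
      ∀ E' : Set (Finset (Fin n')), (∀ T ∈ E', d + 1 ≤ T.card) →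
      I' = Ideal.span (sqm K '' (Set.range f' ∪ E')) →
      (∀ g ∈ Set.range f' ∪ E',
        sqm K g ∉ Ideal.span (sqm K '' ((Set.range f' ∪ E') \ {g}))) →
      SqfreeGenFrom J' (d + 1) →
      sdepth I' J' = d + 1 → depthIJ I' J' ≤ d + 1)
    (hsd : sdepth I J = d + 1) :
    depthIJ I J ≤ d + 1 := by
  classical
  by_contra hdep
  have hK : KoszulVanishesBelow (X : Fin n → MvPolynomial (Fin n) K) (quotMod I J) (d + 2) :=
    koszulVanishesBelow_of_lt_depthIJ (not_le.1 hdep)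
  have hI' : IsSqfreeMonomialIdeal I := ⟨_, hI⟩
  have hJ' : IsSqfreeMonomialIdeal J := hJ.imp fun _ h => h.2
  have hgen : ∀ T, sqm K T ∈ I ↔ ∃ i, f i ⊆ T := fun T => by
    rw [hI, sqm_mem_span_iff]
    simp
  have hfI : ∀ i, sqm K (f i) ∈ I := fun i => (hgen _).2 ⟨i, subset_rfl⟩
  have hJcard : ∀ T, sqm K T ∈ J → d + 1 ≤ T.card := fun T hT => by
    obtain ⟨G, hG, rfl⟩ := hJ
    obtain ⟨T', hT', hs⟩ := sqm_mem_span_iff.1 hT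
    exact (hG T' hT').trans (Finset.card_le_card hs)
  have hfJ : ∀ i, sqm K (f i) ∉ J := fun i h => by
    have := hJcard _ h
    rw [hfd] at this
    omega
  have hdI : ∀ T, sqm K T ∈ I → d ≤ T.card := fun T hT => by
    obtain ⟨i, hi⟩ := (hgen T).1 hT
    exact (hfd i).ge.trans (Finset.card_le_card hi)
  have hfeq : ∀ T, sqm K T ∈ I → T.card = d → ∃ i, f i = T := fun T hT hTd => by
    obtain ⟨i, hi⟩ := (hgen T).1 hT
    exact ⟨i, Finset.eq_of_subset_of_card_le hi (hTd.trans (hfd i).symm).le⟩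
  obtain ⟨c₀, ⟨hc₀, -⟩, hc₀'⟩ := hc
  obtain ⟨t, htc, htf⟩ := Finset.not_subset.1 hc₀'
  have htf' : ∀ i, t ∉ f i := fun i h => htf (Finset.le_sup (f := f) (Finset.mem_univ i) h)
  have htI : ∀ T, sqm K T ∈ I → T.card = d → t ∉ T := fun T hT hTd => by
    obtain ⟨i, rfl⟩ := hfeq T hT hTd
    exact htf' i
  let A : Finset (Finset (Fin n)) :=
    (Finset.univ.image f).filter fun u => sqm K (insert t u) ∉ J
  have hA : ∀ u ∈ A, sqm K u ∈ I ∧ u.card = d ∧ sqm K (insert t u) ∉ J := fun u hu => by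
    obtain ⟨hu, huJ⟩ := Finset.mem_filter.1 hu
    obtain ⟨i, -, rfl⟩ := Finset.mem_image.1 hu
    exact ⟨hfI i, hfd i, huJ⟩
  have hfA : ∀ i, sqm K (insert t (f i)) ∉ J → f i ∈ A := fun i h =>
    Finset.mem_filter.2 ⟨Finset.mem_image_of_mem f (Finset.mem_univ i), h⟩
  have hA₀ : ∀ u ∈ A, u ∈ sqPoset I J := fun u hu =>
    ⟨(hA u hu).1, fun h => (hA u hu).2.2 (sqm_mem_of_subset h (Finset.subset_insert t u))⟩
  obtain ⟨i₀, hi₀⟩ := (hgen c₀).1 hc₀.1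
  have hi₀A : f i₀ ∈ A := hfA i₀ fun h =>
    hc₀.2 (sqm_mem_of_subset h (Finset.insert_subset htc hi₀))
  obtain ⟨c, hc, hcinj⟩ := hK.exists_matching_insert (A := ↑A) hI' hJ' hdI htI hA
  have hpeel : ∀ T, sqm K T ∈ peelIdeal I t A ↔ sqm K T ∈ I ∧ ∀ u ∈ A, T ≠ u ∧ T ≠ insert t u :=
    fun T => sqm_mem_peelIdeal_iff hdI htI fun u hu => (hA u hu).2.1
  have hdpeel : ∀ T, sqm K T ∈ peelIdeal I t A → d ≤ T.card := fun T hT => hdI T ((hpeel T).1 hT).1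
  have hJpeel : J ≤ peelIdeal I t A :=
    le_peelIdeal hdI htI hJ' hJI.le fun u hu => (hA u hu).2
  have hKpeel := hK.quotMod_peelIdeal hI' hJ' hJI.le hdI htI hA
  have hpeel' : IsSqfreeMonomialIdeal (peelIdeal I t A) := isSqfreeMonomialIdeal_peelIdeal
  let s : Finset (Fin r) := Finset.univ.filter fun i => f i ∉ A
  have hs : ∀ T, sqm K T ∈ peelIdeal I t A → T.card = d → ∃ i ∈ s, f i = T := fun T hT hTd => by
    obtain ⟨hTI, hTA⟩ := (hpeel T).1 hT
    obtain ⟨i, rfl⟩ := hfeq T hTI hTd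
    exact ⟨i, Finset.mem_filter.2 ⟨Finset.mem_univ i, fun h => (hTA _ h).1 rfl⟩, rfl⟩
  obtain ⟨F', hF', htop⟩ : ∃ F', IsIntervalPartition (peelIdeal I t A) J F' ∧
      ∀ p ∈ F', d + 2 ≤ p.2.card := by
    rcases s.eq_empty_or_nonempty with hs0 | ⟨i, hi⟩
    · have hd1 : ∀ T, sqm K T ∈ peelIdeal I t A → d + 1 ≤ T.card := fun T hT => by
        refine Nat.lt_of_le_of_ne (hdpeel T hT) fun h => ?_
        obtain ⟨i, hi, -⟩ := hs T hT h.symm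
        simp [hs0] at hi
      obtain ⟨m, hm, hinj⟩ := hKpeel.exists_matching hpeel' hJ' hd1
      exact exists_intervalPartition_of_matching (fun T hT => hd1 T hT.1) hm hinj
    · have hsf : ∀ i ∈ s, sqm K (f i) ∈ peelIdeal I t A := fun i hi => by
        refine (hpeel _).2 ⟨hfI i, fun u hu => ⟨?_, ?_⟩⟩
        · rintro rfl
          exact (Finset.mem_filter.1 hi).2 hu
        · intro h
          exact htf' i (h ▸ Finset.mem_insert_self t u)
      have hi' : f i ∈ sqPoset (peelIdeal I t A) J := ⟨hsf i hi, hfJ i⟩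
      have hlt : J < peelIdeal I t A := lt_of_le_of_ne hJpeel fun h => hi'.2 (h ▸ hi'.1)
      have hdepth : d + 2 ≤ depthIJ (peelIdeal I t A) J :=
        hKpeel.le_depthIJ hpeel' hJ' hi' fun T hT => (hfd i).trans_le (hdpeel T hT)
      let e := s.orderEmbOfFin rfl
      let E : Set (Finset (Fin n)) :=
        {T | Minimal (fun T => sqm K T ∈ peelIdeal I t A) T}
      have hE : Set.range (f ∘ e) ∪ {T ∈ E | d + 1 ≤ T.card} = E := by
        ext T
        constructor
        · rintro (⟨j, rfl⟩ | h)
          · refine ⟨hsf _ (s.orderEmbOfFin_mem rfl j), fun T hT hle => ?_⟩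
            exact (Finset.eq_of_subset_of_card_le hle ((hfd _).trans_le (hdpeel T hT))).ge
          · exact h.1
        · intro (h : Minimal (fun T => sqm K T ∈ peelIdeal I t A) T)
          by_cases hTd : T.card = d
          · obtain ⟨j, hj, rfl⟩ := hs T h.prop hTd
            have hj' : j ∈ Set.range e := by
              rw [Finset.range_orderEmbOfFin]
              exact hj
            obtain ⟨j, rfl⟩ := hj'
            exact Or.inl ⟨j, rfl⟩
          · exact Or.inr ⟨h, Nat.lt_of_le_of_ne (hdpeel T h.prop) (Ne.symm hTd)⟩
      obtain ⟨hspan, hminE⟩ := hpeel'.exists_minimal_generators (E := E) fun T => Iff.rfl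
      have hsd1 : d + 1 ≤ sdepth (peelIdeal I t A) J := by
        obtain ⟨m, hm, hinj⟩ :=
          (hKpeel.mono (Nat.le_succ (d + 1))).exists_matching hpeel' hJ' hdpeel
        exact le_sdepth hi' (exists_intervalPartition_of_matching
          (fun T hT => hdpeel T hT.1) hm hinj)
      have hsd2 : sdepth (peelIdeal I t A) J ≠ d + 1 := fun h => by
        have hsr : s.card < r := by
          conv_rhs => rw [← Fintype.card_fin r]
          exact Finset.card_lt_univ_of_notMem (x := i₀) fun h => (Finset.mem_filter.1 h).2 hi₀A
        have := hind s.card hsr (Finset.card_pos.2 ⟨i, hi⟩) n (peelIdeal I t A) J hlt (f ∘ e)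
          (hfinj.comp e.injective) (fun j => hfd _) {T ∈ E | d + 1 ≤ T.card} (fun T hT => hT.2)
          (by rwa [hE]) (by rwa [hE]) hJ h
        omega
      exact exists_intervalPartition_of_le_sdepth hi' (Nat.succ_pos (d + 1))
        (Nat.lt_of_le_of_ne hsd1 (Ne.symm hsd2))
  have hle := le_sdepth (hA₀ _ hi₀A) (exists_intervalPartition_extend (P := sqPoset I J)
    (P' := sqPoset (peelIdeal I t A) J) (A := ↑A) (d := d) (t := t) (c := c)
    (fun T hT => by
      obtain ⟨i, hi⟩ := (hgen T).1 hT.1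
      exact ⟨f i, ⟨hfI i, hfJ i⟩, hfd i, htf' i, hi⟩)
    hA₀ (fun u hu => (hA u hu).2.1) (fun u hu => htI u (hA u hu).1 (hA u hu).2.1)
    (fun u hu => (hc u hu).1) (fun u hu => (hc u hu).2.2) (fun u hu => (hc u hu).2.1) hcinj
    (fun u hu j hj hjd hjc => by
      obtain ⟨i, rfl⟩ := hfeq j hj.1 hjd
      refine hfA i fun h => (hc u hu).1.2 (sqm_mem_of_subset h (Finset.insert_subset ?_ hjc))
      exact (hc u hu).2.1 (Finset.mem_insert_self t u))
    (fun T => by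
      simp only [sqPoset, Set.mem_ofPred_eq, hpeel, Finset.mem_coe]
      tauto)
    hF' htop)
  omega
end

section
/- Let J ⊊ I be squarefree monomial ideals of S, let d be an integer, and let t ∈ {1,…,n}. Suppose that I ≠ J + I ∩ (x_t) and that depth_S I/(J + I ∩ (x_t)) = d. If depth_S I/J ≥ d+1, then depth_S I/J = d+1. -/
open MvPolynomial

universe u

section RegularSequences

open scoped Pointwise

variable {R : Type u} [CommRing R] {M : Type u} [AddCommGroup M] [Module R M]

open CategoryTheory Abelian Limits RingTheory.Sequence in
lemma exists_isRegular_quotSMulTop [IsNoetherianRing R] [Module.Finite R M] (m : Ideal R)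
    (hM : m • (⊤ : Submodule R M) ≠ ⊤) {y : R} (hy : IsSMulRegular M y) {k : ℕ}
    (h : ∃ rs : List R, rs.length = k + 1 ∧ (∀ r ∈ rs, r ∈ m) ∧ IsRegular M rs)
    (hM' : m • (⊤ : Submodule R (QuotSMulTop y M)) ≠ ⊤) :
    ∃ rs : List R, rs.length = k ∧ (∀ r ∈ rs, r ∈ m) ∧ IsRegular (QuotSMulTop y M) rs := by
  have hsupp : Module.support R (R ⧸ m) = PrimeSpectrum.zeroLocus m := by
    rw [Module.support_eq_zeroLocus, Ideal.annihilator_quotient]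
  obtain ⟨rs, hlen, hmem, hreg⟩ := h
  have hext : ∀ i < k + 1, Subsingleton (Ext (ModuleCat.of R (R ⧸ m)) (ModuleCat.of R M) i) :=
    fun i hi ↦ ModuleCat.subsingleton_ext_of_exists_isRegular m (ModuleCat.of R (R ⧸ m))
      hsupp.subset (ModuleCat.of R M) hM.lt_top rs hmem hreg i (hlen ▸ hi)
  refine ModuleCat.exists_isRegular_of_exists_subsingleton_ext m k
    (ModuleCat.of R (QuotSMulTop y M)) hM'.lt_top (ModuleCat.of R (R ⧸ m)) hsupp fun i hi ↦ ?_
  have zero1 := AddCommGrpCat.isZero_of_iff_subsingleton.mpr (hext i (by omega))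
  have zero2 := AddCommGrpCat.isZero_of_iff_subsingleton.mpr (hext (i + 1) (by omega))
  have hy' : IsSMulRegular (ModuleCat.of R M) y := hy
  exact AddCommGrpCat.subsingleton_of_isZero <| ShortComplex.Exact.isZero_of_both_zeros
    ((Ext.covariant_sequence_exact₃' (ModuleCat.of R (R ⧸ m)) hy'.smulShortComplex_shortExact)
      i (i + 1) rfl) (zero1.eq_zero_of_src _) (zero2.eq_zero_of_tgt _)

lemma RingTheory.Sequence.IsRegular.length_le_supportDim [IsNoetherianRing R]
    [Module.Finite R M] {rs : List R} (h : IsRegular M rs) :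
    (rs.length : WithBot ℕ∞) ≤ Module.supportDim R M := by
  induction rs generalizing M with
  | nil =>
    have := h.nontrivial
    have : Nonempty (Module.support R M) := Module.nonempty_support_of_nontrivial.to_subtype
    simpa [Module.supportDim] using Order.krullDim_nonneg (α := Module.support R M)
  | cons r rs ih =>
    rw [isRegular_cons_iff] at h
    have h1 := ih h.2
    have h2 := Module.supportDim_quotSMulTop_succ_le_of_notMem_minimalPrimes (R := R) (M := M)
      (x := r) (fun _ ↦ h.1.notMem_of_mem_minimalPrimes)
    push_cast [List.length_cons]
    exact (add_le_add_left h1 1).trans h2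

lemma Submodule.exists_addMonoidHom_quotient (P : Submodule R M) (f : M →+ M)
    (hf : ∀ z ∈ P, f z ∈ P) :
    ∃ g : M ⧸ P →+ M ⧸ P, ∀ z, g (P.mkQ z) = P.mkQ (f z) :=
  ⟨QuotientAddGroup.map P.toAddSubgroup P.toAddSubgroup f hf, fun _ ↦ rfl⟩

/-- If there is a regular sequence of length at least two in `a + (x)`, then every element killed by
`a` is `x` times another such element. -/
lemma exists_eq_smul_of_isRegular {a : Ideal R} {x : R} {r s : R} {rs : List R}
    (hr : r ∈ a ⊔ Ideal.span {x}) (hs : s ∈ a ⊔ Ideal.span {x})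
    (h : RingTheory.Sequence.IsWeaklyRegular M (r :: s :: rs)) {z : M} (hz : ∀ c ∈ a, c • z = 0) :
    ∃ w : M, (∀ c ∈ a, c • w = 0) ∧ z = x • w := by
  rw [RingTheory.Sequence.isWeaklyRegular_cons_iff,
    RingTheory.Sequence.isWeaklyRegular_cons_iff] at h
  obtain ⟨hreg, hreg', -⟩ := h
  obtain ⟨r₁, hr₁, r₂, hr₂, rfl⟩ := Submodule.mem_sup.1 hr
  obtain ⟨s₁, hs₁, s₂, hs₂, rfl⟩ := Submodule.mem_sup.1 hs
  obtain ⟨c, rfl⟩ := Ideal.mem_span_singleton'.1 hr₂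
  obtain ⟨e, rfl⟩ := Ideal.mem_span_singleton'.1 hs₂
  have key : (s₁ + e * x) • (c • z) = (r₁ + c * x) • (e • z) := by
    rw [add_smul, add_smul, smul_comm s₁, hz _ hs₁, smul_comm r₁, hz _ hr₁]
    simp only [smul_zero, zero_add, ← mul_smul]
    congr 1; ring
  have h0 : (Submodule.mkQ ((r₁ + c * x) • (⊤ : Submodule R M))) (c • z) = 0 := by
    refine (isSMulRegular_iff_right_eq_zero_of_smul.1 hreg') _ ?_
    rw [← map_smul, key]
    simp only [Submodule.mkQ_apply, Submodule.Quotient.mk_eq_zero]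
    exact Submodule.smul_mem_pointwise_smul _ _ _ trivial
  simp only [Submodule.mkQ_apply, Submodule.Quotient.mk_eq_zero,
    Submodule.mem_smul_pointwise_iff_exists] at h0
  obtain ⟨w, -, hw⟩ := h0
  have hwA : ∀ b ∈ a, b • w = 0 := fun b hb ↦ by
    refine (isSMulRegular_iff_right_eq_zero_of_smul.1 hreg) _ ?_
    rw [smul_comm, hw, smul_comm, hz b hb, smul_zero]
  refine ⟨w, hwA, sub_eq_zero.1 <| (isSMulRegular_iff_right_eq_zero_of_smul.1 hreg) _ ?_⟩
  rw [smul_sub, smul_comm _ x w, hw, add_smul, hz _ hr₁, zero_add, mul_comm c, mul_smul, sub_self]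

lemma exists_isSMulRegular_of_forall_ne_zero [IsNoetherianRing R] [Module.Finite R M]
    {R' : Type*} [CommRing R'] (φ : R' →+* R) (a : Ideal R')
    (h : ∀ z : M, (∀ c ∈ a.map φ, c • z = 0) → z = 0) :
    ∃ y ∈ a, IsSMulRegular M (φ y) := by
  by_contra! hcon
  have hsub : (a : Set R') ⊆ ⋃ p ∈ associatedPrimes R M, (Ideal.comap φ p : Set R') := by
    intro y hy
    have : φ y ∈ ⋃ p ∈ associatedPrimes R M, (p : Set R) := by
      rw [biUnion_associatedPrimes_eq_compl_regular]
      exact hcon y hy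
    simpa using this
  rw [Ideal.subset_union_prime_finite (associatedPrimes.finite R M) ⊤ ⊤
    fun p hp _ _ ↦ have := hp.isPrime; inferInstance] at hsub
  obtain ⟨p, hp, hap⟩ := hsub
  obtain ⟨hprime, z, rfl⟩ := isAssociatedPrime_iff.1 hp
  have hz : z = 0 := h z fun c hc ↦ by simpa using Ideal.map_le_iff_le_comap.2 hap hc
  exact hprime.ne_top (by simp [hz])

lemma smul_top_quotSMulTop_ne_top {m : Ideal R} {r : R} (hr : r ∈ m)
    (hm : m • (⊤ : Submodule R M) ≠ ⊤) : m • (⊤ : Submodule R (QuotSMulTop r M)) ≠ ⊤ := by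
  by_contra eq
  absurd congrArg (Submodule.comap (Submodule.mkQ _)) eq
  simpa [Submodule.comap_smul_top_of_surjective m _ (Submodule.mkQ_surjective _),
    Submodule.smul_mono_left ((Ideal.span_singleton_le_iff_mem m).mpr hr),
    ← Submodule.ideal_span_singleton_smul] using hm

lemma smul_top_ne_top_of_surjective {N : Type*} [AddCommGroup N] [Module R N] {m : Ideal R}
    {π : M →ₗ[R] N} (hπ : Function.Surjective π) (hN : m • (⊤ : Submodule R N) ≠ ⊤) :
    m • (⊤ : Submodule R M) ≠ ⊤ := by
  intro h
  apply hN
  have := congrArg (Submodule.map π) h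
  rwa [Submodule.map_smul'', Submodule.map_top, LinearMap.range_eq_top.2 hπ] at this

/-- Let `p j` be the projections of a grading by powers of `x` on `M`, linear over the image of
`φ`, and let `N` be the degree zero part of `M`, as a quotient of `M`.  Then the depth of `M` is at
most one more than the depth of `N`. -/
theorem exists_isRegular_of_grading [IsNoetherianRing R] {R' : Type*} [CommRing R']
    (φ : R' →+* R) (a : Ideal R') (x : R) {N : Type u} [AddCommGroup N] [Module R N]
    [Module.Finite R M]
    (π : M →ₗ[R] N) (hπ : Function.Surjective π) (p : ℕ → M →+ M)
    (hlin : ∀ j y z, p j (φ y • z) = φ y • p j z)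
    (hpow : ∀ j z, p j (x ^ (j + 1) • z) = 0)
    (hsum : ∀ z, ∃ s : Finset ℕ, ∑ j ∈ s, p j z = z)
    (hidem : ∀ z, p 0 (p 0 z) = p 0 z)
    (hker : ∀ z, π z = 0 ↔ p 0 z = 0)
    (hN : (a.map φ ⊔ Ideal.span {x}) • (⊤ : Submodule R N) ≠ ⊤) (k : ℕ)
    (h : ∃ rs : List R, rs.length = k + 1 ∧ (∀ r ∈ rs, r ∈ a.map φ ⊔ Ideal.span {x}) ∧
      RingTheory.Sequence.IsRegular M rs) :
    ∃ rs : List R, rs.length = k ∧ (∀ r ∈ rs, r ∈ a.map φ ⊔ Ideal.span {x}) ∧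
      RingTheory.Sequence.IsRegular N rs := by
  induction k generalizing M N with
  | zero =>
    have : Nontrivial N := (Submodule.nontrivial_iff R).mp (nontrivial_of_lt _ _ hN.lt_top)
    exact ⟨[], rfl, by simp, .nil R N⟩
  | succ k ih =>
    have hA : ∀ z : M, (∀ c ∈ a.map φ, c • z = 0) → z = 0 := by
      obtain ⟨_ | ⟨r, _ | ⟨s, rs⟩⟩, hlen, hmem, hreg⟩ := h
      · simp at hlen
      · simp at hlen
      have hiter : ∀ j : ℕ, ∀ z : M, (∀ c ∈ a.map φ, c • z = 0) → ∃ w, z = x ^ j • w := by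
        intro j
        induction j with
        | zero => exact fun z _ ↦ ⟨z, by simp⟩
        | succ j ihj =>
          intro z hz
          obtain ⟨w, hw, rfl⟩ := exists_eq_smul_of_isRegular (hmem r (by simp))
            (hmem s (by simp)) hreg.toIsWeaklyRegular hz
          obtain ⟨v, rfl⟩ := ihj w hw
          exact ⟨v, by rw [← mul_smul, pow_succ']⟩
      intro z hz
      obtain ⟨s, hs⟩ := hsum z
      rw [← hs]
      refine Finset.sum_eq_zero fun j _ ↦ ?_
      obtain ⟨w, rfl⟩ := hiter (j + 1) z hz
      exact hpow j w
    obtain ⟨y, hya, hy⟩ := exists_isSMulRegular_of_forall_ne_zero φ a hA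
    have hym : φ y ∈ a.map φ ⊔ Ideal.span {x} :=
      Ideal.mem_sup_left (Ideal.mem_map_of_mem φ hya)
    have hM := smul_top_ne_top_of_surjective hπ hN
    have hred := exists_isRegular_quotSMulTop _ hM hy h (smul_top_quotSMulTop_ne_top hym hM)
    have hstab : ∀ j, ∀ z ∈ φ y • (⊤ : Submodule R M), p j z ∈ φ y • (⊤ : Submodule R M) := by
      intro j z hz
      obtain ⟨w, -, rfl⟩ := (Submodule.mem_smul_pointwise_iff_exists _ _ _).1 hz
      rw [hlin]
      exact Submodule.smul_mem_pointwise_smul _ _ _ trivial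
    choose q hq using fun j ↦ (φ y • (⊤ : Submodule R M)).exists_addMonoidHom_quotient (p j)
      (hstab j)
    have hsurj := (φ y • (⊤ : Submodule R M)).mkQ_surjective
    obtain ⟨rs, hlen, hmem, hreg⟩ := ih (M := QuotSMulTop (φ y) M) (N := QuotSMulTop (φ y) N)
      (QuotSMulTop.map (φ y) π) (QuotSMulTop.map_surjective (φ y) hπ) q
      (fun j c ↦ hsurj.forall.2 fun z ↦ by rw [← map_smul, hq, hlin, map_smul, hq])
      (fun j ↦ hsurj.forall.2 fun z ↦ by rw [← map_smul, hq, hpow, map_zero])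
      (hsurj.forall.2 fun z ↦ by
        obtain ⟨s, hs⟩ := hsum z
        exact ⟨s, by simp only [hq]; rw [← map_sum, hs]⟩)
      (hsurj.forall.2 fun z ↦ by rw [hq, hq, hidem])
      (hsurj.forall.2 fun z ↦ by
        rw [hq]
        change (φ y • (⊤ : Submodule R N)).mkQ (π z) = 0 ↔ _
        simp only [Submodule.mkQ_apply, Submodule.Quotient.mk_eq_zero,
          Submodule.mem_smul_pointwise_iff_exists, Submodule.mem_top, true_and]
        constructor
        · rintro ⟨w, hw⟩
          obtain ⟨w, rfl⟩ := hπ w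
          refine ⟨p 0 w, ?_⟩
          rw [← hlin, ← sub_eq_zero, ← map_sub, ← hker, map_sub, map_smul, hw, sub_self]
        · rintro ⟨w, hw⟩
          refine ⟨π w, ?_⟩
          rw [← sub_eq_zero, ← map_smul, ← map_sub, hker, map_sub, hw, hidem, sub_self])
      (smul_top_quotSMulTop_ne_top hym hN) hred
    refine ⟨φ y :: rs, by simp [hlen], by simpa [hym] using hmem, .cons ?_ hreg⟩
    refine isSMulRegular_iff_right_eq_zero_of_smul.2 (hπ.forall.2 fun z hz ↦ ?_)
    rw [← map_smul, hker, hlin] at hz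
    exact (hker z).2 ((isSMulRegular_iff_right_eq_zero_of_smul.1 hy) _ hz)

end RegularSequences

section MonomialIdeals

variable {K : Type u} [Field K] {n : ℕ}

/-- An ideal containing every monomial that occurs in one of its elements. -/
def IsMonomialIdeal (L : Ideal (MvPolynomial (Fin n) K)) : Prop :=
  ∀ f ∈ L, ∀ m ∈ f.support, monomial m (1 : K) ∈ L

lemma IsMonomialIdeal.mem_of_support {L : Ideal (MvPolynomial (Fin n) K)}
    {f : MvPolynomial (Fin n) K} (h : ∀ m ∈ f.support, monomial m (1 : K) ∈ L) : f ∈ L := by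
  rw [f.as_sum]
  refine L.sum_mem fun m hm ↦ ?_
  simpa [C_mul_monomial] using L.mul_mem_left (C (coeff m f)) (h m hm)

lemma IsMonomialIdeal.of_span_image (s : Set (Fin n →₀ ℕ)) :
    IsMonomialIdeal (Ideal.span ((fun m ↦ monomial m (1 : K)) '' s)) := by
  intro f hf m hm
  rw [mem_ideal_span_monomial_image] at hf ⊢
  intro m' hm'
  obtain rfl : m = m' := by
    by_contra h
    simp [h] at hm'
  exact hf m hm

lemma IsSqfreeMonomialIdeal.isMonomialIdeal {L : Ideal (MvPolynomial (Fin n) K)}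
    (h : IsSqfreeMonomialIdeal L) : IsMonomialIdeal L := by
  obtain ⟨G, rfl⟩ := h
  have : sqm K '' G = (fun m ↦ monomial m (1 : K)) ''
      ((fun T : Finset (Fin n) ↦ ∑ i ∈ T, Finsupp.single i 1) '' G) := by
    rw [Set.image_image]
    refine Set.image_congr fun T _ ↦ ?_
    rw [monomial_sum_one]
    rfl
  rw [this]
  exact .of_span_image _

lemma IsMonomialIdeal.sup {L L' : Ideal (MvPolynomial (Fin n) K)} (h : IsMonomialIdeal L)
    (h' : IsMonomialIdeal L') : IsMonomialIdeal (L ⊔ L') := by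
  classical
  intro f hf m hm
  obtain ⟨g, hg, g', hg', rfl⟩ := Submodule.mem_sup.1 hf
  rcases Finset.mem_union.1 (support_add hm) with hm | hm
  · exact Ideal.mem_sup_left (h g hg m hm)
  · exact Ideal.mem_sup_right (h' g' hg' m hm)

lemma IsMonomialIdeal.inf {L L' : Ideal (MvPolynomial (Fin n) K)} (h : IsMonomialIdeal L)
    (h' : IsMonomialIdeal L') : IsMonomialIdeal (L ⊓ L') :=
  fun f hf m hm ↦ ⟨h f hf.1 m hm, h' f hf.2 m hm⟩

lemma mem_span_singleton_X_iff {t : Fin n} {f : MvPolynomial (Fin n) K} :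
    f ∈ Ideal.span {X t} ↔ ∀ m ∈ f.support, m t ≠ 0 := by
  simpa using mem_ideal_span_X_image (x := f) (s := {t})

lemma isMonomialIdeal_span_singleton_X (t : Fin n) :
    IsMonomialIdeal (Ideal.span {(X t : MvPolynomial (Fin n) K)}) := by
  intro f hf m hm
  rw [mem_span_singleton_X_iff] at hf ⊢
  intro m' hm'
  obtain rfl : m = m' := by
    by_contra h
    simp [h] at hm'
  exact hf m hm

/-- The part of a polynomial of degree `j` in the variable `X t`. -/
noncomputable def degreeOfComponent (t : Fin n) (j : ℕ) :
    MvPolynomial (Fin n) K →ₗ[K] MvPolynomial (Fin n) K :=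
  weightedHomogeneousComponent (Pi.single t 1) j

lemma coeff_degreeOfComponent (t : Fin n) (j : ℕ) (f : MvPolynomial (Fin n) K)
    (m : Fin n →₀ ℕ) :
    coeff m (degreeOfComponent t j f) = if m t = j then coeff m f else 0 := by
  rw [degreeOfComponent, coeff_weightedHomogeneousComponent]
  congr 2
  simp [Finsupp.weight_apply, Finsupp.sum_fintype, Pi.single_apply]

lemma degreeOfComponent_rename_mul (t : Fin n) (j : ℕ) (y : MvPolynomial {i // i ≠ t} K)
    (f : MvPolynomial (Fin n) K) :
    degreeOfComponent t j (rename Subtype.val y * f) =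
      rename Subtype.val y * degreeOfComponent t j f := by
  induction y using MvPolynomial.induction_on generalizing f with
  | C c => ext m; simp [coeff_degreeOfComponent, coeff_C_mul]
  | add p q hp hq => simp only [map_add, add_mul, hp, hq]
  | mul_X p i hp =>
    simp only [map_mul, mul_assoc, hp, rename_X]
    congr 1
    ext m
    simp only [coeff_degreeOfComponent, coeff_X_mul']
    simp [i.2]
    split_ifs <;> rfl

lemma degreeOfComponent_X_pow_mul (t : Fin n) (j : ℕ) (f : MvPolynomial (Fin n) K) :
    degreeOfComponent t j (X t ^ (j + 1) * f) = 0 := by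
  ext m
  rw [coeff_degreeOfComponent, X_pow_eq_monomial, coeff_monomial_mul', coeff_zero]
  split_ifs with h1 h2
  · have := h2 t
    simp at this
    omega
  all_goals rfl

lemma exists_sum_degreeOfComponent (t : Fin n) (f : MvPolynomial (Fin n) K) :
    ∃ s : Finset ℕ, ∑ j ∈ s, degreeOfComponent t j f = f := by
  refine ⟨f.support.image (· t), ?_⟩
  ext m
  simp only [coeff_sum, coeff_degreeOfComponent, Finset.sum_ite_eq]
  split_ifs with h
  · rfl
  · by_contra hm
    exact h (Finset.mem_image_of_mem _ (mem_support_iff.2 (Ne.symm hm)))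

lemma IsMonomialIdeal.degreeOfComponent_mem {L : Ideal (MvPolynomial (Fin n) K)}
    (h : IsMonomialIdeal L) (t : Fin n) (j : ℕ) {f : MvPolynomial (Fin n) K} (hf : f ∈ L) :
    degreeOfComponent t j f ∈ L := by
  refine mem_of_support fun m hm ↦ h f hf m ?_
  rw [mem_support_iff, coeff_degreeOfComponent] at hm
  rw [mem_support_iff]
  exact fun h0 ↦ hm (by simp [h0])

lemma sub_degreeOfComponent_zero_mem (t : Fin n) (f : MvPolynomial (Fin n) K) :
    f - degreeOfComponent t 0 f ∈ Ideal.span {X t} := by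
  rw [mem_span_singleton_X_iff]
  intro m hm h0
  rw [mem_support_iff, coeff_sub, coeff_degreeOfComponent] at hm
  simp [h0] at hm

lemma degreeOfComponent_zero_of_mem {t : Fin n} {f : MvPolynomial (Fin n) K}
    (hf : f ∈ Ideal.span {X t}) : degreeOfComponent t 0 f = 0 := by
  rw [mem_span_singleton_X_iff] at hf
  ext m
  rw [coeff_degreeOfComponent, coeff_zero]
  split_ifs with h
  · by_contra hm
    exact hf m (mem_support_iff.2 hm) h
  · rfl

lemma IsMonomialIdeal.mem_sup_inf_span_X_iff {I J : Ideal (MvPolynomial (Fin n) K)}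
    (hI : IsMonomialIdeal I) (hJ : IsMonomialIdeal J) (t : Fin n)
    {f : MvPolynomial (Fin n) K} (hf : f ∈ I) :
    f ∈ J ⊔ I ⊓ Ideal.span {X t} ↔ degreeOfComponent t 0 f ∈ J := by
  constructor
  · intro h
    obtain ⟨g, hg, g', hg', rfl⟩ := Submodule.mem_sup.1 h
    rw [map_add, degreeOfComponent_zero_of_mem hg'.2, add_zero]
    exact hJ.degreeOfComponent_mem t 0 hg
  · intro h
    rw [← add_sub_cancel (degreeOfComponent t 0 f) f]
    exact add_mem (Ideal.mem_sup_left h) (Ideal.mem_sup_right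
      ⟨sub_mem hf (hI.degreeOfComponent_mem t 0 hf), sub_degreeOfComponent_zero_mem t f⟩)

lemma map_rename_sup_span_X (t : Fin n) :
    (Ideal.span (Set.range X)).map
        (rename Subtype.val : MvPolynomial {i // i ≠ t} K →ₐ[K] MvPolynomial (Fin n) K).toRingHom ⊔
      Ideal.span {X t} = Ideal.span (Set.range X) := by
  rw [Ideal.map_span, ← Ideal.span_union]
  congr 1
  ext f
  constructor
  · rintro (⟨_, ⟨i, rfl⟩, rfl⟩ | rfl)
    · exact ⟨i, by simp⟩
    · exact ⟨t, rfl⟩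
  · rintro ⟨i, rfl⟩
    by_cases h : i = t
    · exact Or.inr (by simp [h])
    · exact Or.inl ⟨X ⟨i, h⟩, ⟨_, rfl⟩, by simp⟩

lemma constantCoeff_eq_zero_of_mem_span_X {f : MvPolynomial (Fin n) K}
    (hf : f ∈ Ideal.span (Set.range X)) : constantCoeff f = 0 := by
  have : Ideal.span (Set.range (X : Fin n → MvPolynomial (Fin n) K)) ≤
      RingHom.ker (constantCoeff (R := K) (σ := Fin n)) := by
    rw [Ideal.span_le]
    rintro _ ⟨i, rfl⟩
    simp
  exact this hf

lemma IsMonomialIdeal.smul_top_quotMod_ne_top {I J : Ideal (MvPolynomial (Fin n) K)}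
    (hI : IsMonomialIdeal I) (hJ : IsMonomialIdeal J) (h : ¬ I ≤ J) :
    Ideal.span (Set.range (X : Fin n → MvPolynomial (Fin n) K)) •
      (⊤ : Submodule (MvPolynomial (Fin n) K) (quotMod I J)) ≠ ⊤ := by
  intro htop
  obtain ⟨r, hr, hr0⟩ := Submodule.exists_sub_one_mem_and_smul_eq_zero_of_fg_of_le_smul _ _
    (Module.Finite.fg_top (R := MvPolynomial (Fin n) K) (M := quotMod I J)) htop.ge
  apply h
  intro f hf
  refine mem_of_support fun m hm ↦ ?_
  have hmI := hI f hf m hm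
  have h1 : r * monomial m 1 ∈ J := by
    have := hr0 (Submodule.Quotient.mk ⟨_, hmI⟩) trivial
    rwa [← Submodule.Quotient.mk_smul, Submodule.Quotient.mk_eq_zero] at this
  refine hJ _ h1 m ?_
  have h2 := constantCoeff_eq_zero_of_mem_span_X hr
  rw [map_sub, map_one, sub_eq_zero] at h2
  rw [mem_support_iff, coeff_mul_monomial', if_pos le_rfl, tsub_self, mul_one]
  rw [constantCoeff_eq] at h2
  simp [h2]

lemma exists_isRegular_quotMod_sup_inf_span_X {I J : Ideal (MvPolynomial (Fin n) K)}
    (hI : IsMonomialIdeal I) (hJ : IsMonomialIdeal J) (t : Fin n)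
    (hne : ¬ I ≤ J ⊔ I ⊓ Ideal.span {X t}) (k : ℕ)
    (h : ∃ rs : List (MvPolynomial (Fin n) K), rs.length = k + 1 ∧
      (∀ r ∈ rs, r ∈ Ideal.span (Set.range X)) ∧
      RingTheory.Sequence.IsRegular (quotMod I J) rs) :
    ∃ rs : List (MvPolynomial (Fin n) K), rs.length = k ∧
      (∀ r ∈ rs, r ∈ Ideal.span (Set.range X)) ∧
      RingTheory.Sequence.IsRegular (quotMod I (J ⊔ I ⊓ Ideal.span {X t})) rs := by
  set J' := J ⊔ I ⊓ Ideal.span {X t}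
  have hle : Submodule.comap I.subtype J ≤ Submodule.comap I.subtype J' :=
    Submodule.comap_mono le_sup_left
  let P : Submodule (MvPolynomial (Fin n) K) I := Submodule.comap I.subtype J
  let e (j : ℕ) : I →+ I :=
    { toFun := fun f ↦ ⟨degreeOfComponent t j f, hI.degreeOfComponent_mem t j f.2⟩
      map_zero' := by ext1; simp
      map_add' := fun _ _ ↦ by ext1; simp }
  have he (j : ℕ) (f : I) : (e j f : MvPolynomial (Fin n) K) = degreeOfComponent t j f := rfl
  choose p hp using fun j ↦ P.exists_addMonoidHom_quotient (e j)
    fun z hz ↦ hJ.degreeOfComponent_mem t j hz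
  have hN := hI.smul_top_quotMod_ne_top
    (hJ.sup (hI.inf (isMonomialIdeal_span_singleton_X t))) hne
  rw [← map_rename_sup_span_X t] at h hN ⊢
  refine exists_isRegular_of_grading (M := quotMod I J) (N := quotMod I J')
    (rename Subtype.val : MvPolynomial {i // i ≠ t} K →ₐ[K] MvPolynomial (Fin n) K).toRingHom
    (Ideal.span (Set.range X)) (X t) (Submodule.factor hle)
    (Submodule.factor_surjective hle) p ?_ ?_ ?_ ?_ ?_ hN k h
  · refine fun j y ↦ P.mkQ_surjective.forall.2 fun z ↦ ?_
    rw [← map_smul, hp, hp, ← map_smul]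
    congr 1
    ext1
    exact degreeOfComponent_rename_mul t j y z
  · refine fun j ↦ P.mkQ_surjective.forall.2 fun z ↦ ?_
    have hz : e j ((X t : MvPolynomial (Fin n) K) ^ (j + 1) • z) = 0 := by
      ext1
      rw [he, Submodule.coe_smul, smul_eq_mul, degreeOfComponent_X_pow_mul, Submodule.coe_zero]
    rw [← map_smul, hp, hz, map_zero]
  · refine P.mkQ_surjective.forall.2 fun z ↦ ?_
    obtain ⟨s, hs⟩ := exists_sum_degreeOfComponent t (z : MvPolynomial (Fin n) K)
    refine ⟨s, ?_⟩
    simp only [hp]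
    rw [← map_sum]
    congr 1
    ext1
    simpa [he] using hs
  · refine P.mkQ_surjective.forall.2 fun z ↦ ?_
    rw [hp, hp]
    congr 1
    ext m
    simp only [he, coeff_degreeOfComponent]
    split_ifs <;> rfl
  · refine P.mkQ_surjective.forall.2 fun z ↦ ?_
    rw [hp]
    change (Submodule.Quotient.mk z : I ⧸ Submodule.comap I.subtype J') = 0 ↔
      (Submodule.Quotient.mk (e 0 z) : I ⧸ P) = 0
    rw [Submodule.Quotient.mk_eq_zero, Submodule.Quotient.mk_eq_zero]
    exact hI.mem_sup_inf_span_X_iff hJ t z.2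

lemma length_le_of_isRegular {M : Type u} [AddCommGroup M] [Module (MvPolynomial (Fin n) K) M]
    [Module.Finite (MvPolynomial (Fin n) K) M] {rs : List (MvPolynomial (Fin n) K)}
    (h : RingTheory.Sequence.IsRegular M rs) : rs.length ≤ n := by
  have h1 := h.length_le_supportDim.trans (Module.supportDim_le_ringKrullDim _ _)
  rw [MvPolynomial.ringKrullDim_of_isNoetherianRing, ringKrullDim_eq_zero_of_field, zero_add,
    Nat.card_fin] at h1
  exact_mod_cast h1

end MonomialIdeals

/-- if `I ≠ J + I ∩ (x_t)`, `depth I/(J + I ∩ (x_t)) = d` and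
`depth I/J ≥ d+1`, then `depth I/J = d+1`. -/
theorem statement4 {K : Type*} [Field K] {n : ℕ}
    (I J : Ideal (MvPolynomial (Fin n) K))
    (hI : IsSqfreeMonomialIdeal I) (hJ : IsSqfreeMonomialIdeal J) (hJI : J < I)
    (d : ℕ) (t : Fin n)
    (hne : I ≠ J ⊔ (I ⊓ Ideal.span {X t}))
    (hdep : depthIJ I (J ⊔ (I ⊓ Ideal.span {X t})) = d)
    (hge : d + 1 ≤ depthIJ I J) :
    depthIJ I J = d + 1 := by
  refine le_antisymm ?_ hge
  have hne' : ¬ I ≤ J ⊔ I ⊓ Ideal.span {X t} :=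
    fun h ↦ hne (le_antisymm h (sup_le hJI.le inf_le_left))
  have hmem : depthIJ I J ∈ {k | ∃ rs : List (MvPolynomial (Fin n) K), rs.length = k ∧
      (∀ r ∈ rs, r ∈ Ideal.span (Set.range X : Set (MvPolynomial (Fin n) K))) ∧
      RingTheory.Sequence.IsRegular (quotMod I J) rs} := by
    refine Nat.sSup_mem (Set.nonempty_iff_ne_empty.2 fun h ↦ ?_) ⟨n, ?_⟩
    · rw [depthIJ, mdepth, h, csSup_empty] at hge
      simp at hge
    · rintro _ ⟨rs, rfl, -, h⟩
      exact length_le_of_isRegular h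
  obtain ⟨k, hk⟩ := Nat.exists_eq_add_of_le' (Nat.le_of_add_left_le hge : 1 ≤ depthIJ I J)
  rw [hk] at hmem ⊢
  have h := exists_isRegular_quotMod_sup_inf_span_X hI.isMonomialIdeal hJ.isMonomialIdeal t hne' k
    hmem
  rw [← hdep]
  refine Nat.succ_le_succ (le_csSup ⟨n, ?_⟩ h)
  rintro _ ⟨rs, rfl, -, h⟩
  exact length_le_of_isRegular h
end
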